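/- arXiv:1709.05049 — 2 statements merged into one kernel-verified Lean document; each statement's English description precedes it below -/
import Mathlib

section
/- Let ρ: sτtilt Λ → sτtilt Γ be a poset isomorphism, with induced quiver isomorphism σ: Q* → (Q')*. Then for every subset V ⊆ Q_0 and every i ∈ Q_0 with i ∉ V, one has supp(e_{σ(i)}(Γ/(Σ_{v∈V} e_{σ(v)}))) = σ(supp(e_i(Λ/(Σ_{v∈V} e_v)))). -/
/-!
Common framework for formalizing statements from
"From support τ-tilting posets to algebras" (R. Kase).

Modules over the basic finite dimensional algebra `Λ` are taken to be *right*
modules, encoded as (left) modules over the opposite ring `Λᵐᵒᵖ`.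
τ-rigidity is encoded through the Auslander–Smalø criterion:
`Hom(M, τM) = 0` iff `Ext¹(M, Fac M) = 0`, and the vanishing of `Ext¹(M, X)`
is encoded by the splitting of all short exact sequences `0 → X → E → M → 0`.
-/

open MulOpposite

namespace TauTilting

/-- Bundled modules over `A` (in `Type 0`). -/
abbrev Mdl (A : Type) [Ring A] := ModuleCat.{0} A

variable {A B : Type} [Ring A] [Ring B]

/-- `X ∈ Fac M` : `X` is a factor of a finite direct sum of copies of `M`. -/
def MemFac (M X : Mdl A) : Prop :=
  ∃ (n : ℕ) (f : (Fin n → M) →ₗ[A] X), Function.Surjective f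

/-- Every short exact sequence `0 → X → E → M → 0` splits, i.e. `Ext¹(M, X) = 0`. -/
def Ext1Vanish (M X : Mdl A) : Prop :=
  ∀ (E : Mdl A) (f : X →ₗ[A] E) (g : E →ₗ[A] M),
    Function.Injective f → Function.Surjective g →
    LinearMap.range f = LinearMap.ker g →
    ∃ s : M →ₗ[A] E, g.comp s = LinearMap.id

/-- `M` is τ-rigid (Auslander–Smalø: `Hom(M, τM) = 0 ↔ Ext¹(M, Fac M) = 0`). -/
def IsTauRigid (M : Mdl A) : Prop :=
  Module.Finite A M ∧ ∀ X : Mdl A, MemFac M X → Ext1Vanish M X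

/-- `M` is indecomposable. -/
def IsIndec (M : Mdl A) : Prop :=
  Nontrivial M ∧ ∀ N N' : Submodule A M, IsCompl N N' → N = ⊥ ∨ N' = ⊥

/-- `F` is an (internal) decomposition of `M` into indecomposable direct summands. -/
def IsDecompOf (M : Mdl A) {n : ℕ} (F : Fin n → Submodule A M) : Prop :=
  iSupIndep F ∧ iSup F = ⊤ ∧ ∀ k, IsIndec (ModuleCat.of A (F k))

/-- `|M| = n` : `M` decomposes into `n` indecomposable direct summands. -/
def HasNumSummands (M : Mdl A) (n : ℕ) : Prop :=
  ∃ F : Fin n → Submodule A M, IsDecompOf M F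

/-- `M` is basic: its indecomposable direct summands are pairwise non-isomorphic. -/
def IsBasicMod (M : Mdl A) : Prop :=
  ∃ (n : ℕ) (F : Fin n → Submodule A M), IsDecompOf M F ∧
    ∀ k l : Fin n, k ≠ l → IsEmpty (↥(F k) ≃ₗ[A] ↥(F l))

def ModIso (M N : Mdl A) : Prop := Nonempty (M ≃ₗ[A] N)

/-- The order on support τ-tilting modules: `M ≤ N ↔ Fac M ⊆ Fac N`. -/
def FacLE (M N : Mdl A) : Prop := ∀ X : Mdl A, MemFac M X → MemFac N X
def FacLT (M N : Mdl A) : Prop := FacLE M N ∧ ¬ FacLE N M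
/-- Equality in the poset of iso-classes: mutual `≤`. -/
def PE (M N : Mdl A) : Prop := FacLE M N ∧ FacLE N M

/-- `N` is a direct summand of `M`. -/
def IsSummand (N M : Mdl A) : Prop :=
  ∃ (f : N →ₗ[A] M) (g : M →ₗ[A] N), g.comp f = LinearMap.id
/-- `N ∈ add M`. -/
def InAdd (N M : Mdl A) : Prop := ∃ n : ℕ, IsSummand N (ModuleCat.of A (Fin n → M))
def HomZero (R M : Mdl A) : Prop := ∀ f : R →ₗ[A] M, f = 0

/-- Direct sum of two bundled modules. -/
def dsum (M N : Mdl A) : Mdl A := ModuleCat.of A (M × N)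

/-- Hasse-quiver arrow `M → N` (so `N` is a direct successor of `M`, and `M` a
direct predecessor of `N`) in the poset of all modules satisfying `P`,
ordered by `FacLE`. -/
def HArrow (P : Mdl A → Prop) (M N : Mdl A) : Prop :=
  P M ∧ P N ∧ FacLT N M ∧ ∀ C, P C → FacLT N C → FacLT C M → False

def IsMaxOf (P : Mdl A → Prop) (T : Mdl A) : Prop := P T ∧ ∀ S, P S → FacLE S T
def IsMinOf (P : Mdl A → Prop) (T : Mdl A) : Prop := P T ∧ ∀ S, P S → FacLE T S

/-- `T` has exactly `n` direct successors (counted up to poset equality). -/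
def SuccsCard (P : Mdl A → Prop) (T : Mdl A) (n : ℕ) : Prop :=
  ∃ g : Fin n → Mdl A, (∀ k, HArrow P T (g k)) ∧
    (∀ k l, k ≠ l → ¬ PE (g k) (g l)) ∧ ∀ S, HArrow P T S → ∃ k, PE S (g k)

/-- `T` has exactly `n` direct predecessors (counted up to poset equality). -/
def PredsCard (P : Mdl A → Prop) (T : Mdl A) (n : ℕ) : Prop :=
  ∃ g : Fin n → Mdl A, (∀ k, HArrow P (g k) T) ∧
    (∀ k l, k ≠ l → ¬ PE (g k) (g l)) ∧ ∀ S, HArrow P S T → ∃ k, PE S (g k)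

/-- The poset of modules satisfying `P` (ordered by `FacLE`) is a lattice. -/
def IsLatticeP (P : Mdl A → Prop) : Prop :=
  ∀ M N, P M → P N →
    (∃ J, P J ∧ FacLE M J ∧ FacLE N J ∧ ∀ C, P C → FacLE M C → FacLE N C → FacLE J C) ∧
    (∃ W, P W ∧ FacLE W M ∧ FacLE W N ∧ ∀ C, P C → FacLE C M → FacLE C N → FacLE C W)

/-- A poset isomorphism between the posets (of isomorphism classes) of modules
satisfying `PA` resp. `PB`, ordered by `FacLE`. -/
structure PosetIsoP (PA : Mdl A → Prop) (PB : Mdl B → Prop) where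
  toFun : Mdl A → Mdl B
  invFun : Mdl B → Mdl A
  maps : ∀ M, PA M → PB (toFun M)
  maps' : ∀ N, PB N → PA (invFun N)
  le_iff : ∀ M N, PA M → PA N → (FacLE M N ↔ FacLE (toFun M) (toFun N))
  le_iff' : ∀ M N, PB M → PB N → (FacLE M N ↔ FacLE (invFun M) (invFun N))
  left_inv : ∀ M, PA M → PE (invFun (toFun M)) M
  right_inv : ∀ N, PB N → PE (toFun (invFun N)) N

/-- A poset isomorphism between the poset of modules satisfying `P` and an
abstract poset `(β, le)`. -/
structure PosetIsoTo (P : Mdl A → Prop) (β : Type) (le : β → β → Prop) where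
  toFun : Mdl A → β
  invFun : β → Mdl A
  maps' : ∀ b, P (invFun b)
  le_iff : ∀ M N, P M → P N → (FacLE M N ↔ le (toFun M) (toFun N))
  left_inv : ∀ M, P M → PE (invFun (toFun M)) M
  right_inv : ∀ b, toFun (invFun b) = b

/-! ### Ring-level notions -/

variable (Λ : Type) [Ring Λ]

/-- The right ideal generated by a subset, as a right module (i.e. `Λᵐᵒᵖ`-module). -/
def rSpan (S : Set Λ) : Submodule Λᵐᵒᵖ Λ := Submodule.span Λᵐᵒᵖ S
/-- The two-sided ideal `(q) = ΛqΛ`, as a right `Λ`-module. -/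
def tIdeal (q : Λ) : Submodule Λᵐᵒᵖ Λ := Submodule.span Λᵐᵒᵖ {y : Λ | ∃ a : Λ, y = a * q}
/-- The right `Λ`-module `Λ/S`. -/
def quotMod (S : Submodule Λᵐᵒᵖ Λ) : Mdl Λᵐᵒᵖ := ModuleCat.of Λᵐᵒᵖ (Λ ⧸ S)
/-- `Λ` as a right module over itself. -/
def regMod : Mdl Λᵐᵒᵖ := ModuleCat.of Λᵐᵒᵖ Λ
/-- The projective right module `xΛ ≅ Λ/(1-x)Λ` attached to an idempotent `x`. -/
def projMod (x : Λ) : Mdl Λᵐᵒᵖ := quotMod Λ (rSpan Λ {1 - x})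
/-- The right `Λ`-module `Λ/(1-x)`; for `x = e i` this is the module `X_i`. -/
def cyclicQuot (x : Λ) : Mdl Λᵐᵒᵖ := quotMod Λ (tIdeal Λ (1 - x))

/-- `x` is a primitive idempotent. -/
def IsPrimIdem (x : Λ) : Prop :=
  IsIdempotentElem x ∧ x ≠ 0 ∧
    ∀ a b : Λ, IsIdempotentElem a → IsIdempotentElem b →
      a * b = 0 → b * a = 0 → a + b = x → a = 0 ∨ b = 0

variable {ι : Type} [Fintype ι]

/-- `e` is a complete family of orthogonal primitive idempotents of `Λ`. -/
def CompletePrimIdems (e : ι → Λ) : Prop :=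
  (∀ i, IsPrimIdem Λ (e i)) ∧ (Pairwise fun i j => e i * e j = 0) ∧ ∑ i, e i = 1

/-- `Λ` is basic w.r.t. `e`: the `e i Λ` are pairwise non-isomorphic. -/
def IsBasicAlg (e : ι → Λ) : Prop :=
  ∀ i j : ι, i ≠ j → IsEmpty (↥(projMod Λ (e i)) ≃ₗ[Λᵐᵒᵖ] ↥(projMod Λ (e j)))

/-- The support `supp(M) = {i | M·eᵢ ≠ 0}` of a right module `M`. -/
def Supp (e : ι → Λ) (M : Mdl Λᵐᵒᵖ) : Set ι := {i | ∃ m : M, op (e i) • m ≠ 0}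

/-- Support τ-tilting module: τ-rigid with `|M| = #supp(M)`. -/
def IsSTT (e : ι → Λ) (M : Mdl Λᵐᵒᵖ) : Prop :=
  Module.Finite Λᵐᵒᵖ M ∧ IsTauRigid M ∧ HasNumSummands M (Supp Λ e M).ncard

/-- Basic support τ-tilting module. -/
def IsBSTT (e : ι → Λ) (M : Mdl Λᵐᵒᵖ) : Prop := IsSTT Λ e M ∧ IsBasicMod M

/-- τ-tilting module: τ-rigid with `|M| = #Q₀`. -/
def IsTauTiltingMod (e : ι → Λ) (M : Mdl Λᵐᵒᵖ) : Prop :=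
  IsSTT Λ e M ∧ HasNumSummands M (Fintype.card ι)

open scoped Classical in
/-- The idempotent `1 - e_M = Σ_{i ∉ supp M} e i`. -/
noncomputable def cIdem (e : ι → Λ) (M : Mdl Λᵐᵒᵖ) : Λ :=
  ∑ i : ι, if i ∈ Supp Λ e M then 0 else e i

/-- τ-rigid pair `(M, P)`. -/
def IsTauRigidPair (e : ι → Λ) (M P : Mdl Λᵐᵒᵖ) : Prop :=
  IsTauRigid M ∧ Module.Finite Λᵐᵒᵖ P ∧ Module.Projective Λᵐᵒᵖ P ∧
    InAdd P (projMod Λ (cIdem Λ e M))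

/-- Basic τ-rigid pair. -/
def IsBasicTRP (e : ι → Λ) (M P : Mdl Λᵐᵒᵖ) : Prop :=
  IsTauRigidPair Λ e M P ∧ IsBasicMod M ∧ IsBasicMod P

/-- `T ∈ sτtilt_{(N,R)} Λ`, i.e. `N ∈ add T` and `Hom(R, T) = 0`. -/
def InPairSet (N R T : Mdl Λᵐᵒᵖ) : Prop := InAdd N T ∧ HomZero R T

/-- `Λ` is τ-tilting finite: finitely many basic support τ-tilting modules up to iso. -/
def TauTiltingFinite (e : ι → Λ) : Prop :=
  ∃ (n : ℕ) (T : Fin n → Mdl Λᵐᵒᵖ), ∀ M, IsBSTT Λ e M → ∃ k, ModIso M (T k)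

/-- The Jacobson radical of `Λ`, as a `K`-subspace. -/
noncomputable def radK (K : Type) [CommRing K] (Λ : Type) [Ring Λ] [Algebra K Λ] :
    Submodule K Λ :=
  Submodule.restrictScalars K (sInf {I : Ideal Λ | I.IsMaximal})

/-- Powers of the radical, with `rad⁰ = Λ`. -/
noncomputable def radPow (K : Type) [CommRing K] (Λ : Type) [Ring Λ] [Algebra K Λ] :
    ℕ → Submodule K Λ
  | 0 => ⊤
  | n + 1 => radK K Λ ^ (n + 1)

/-! ### Quivers, paths and presentations -/

/-- Paths in a quiver with vertex set `ι` and arrow types `Arr i j`. -/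
inductive QPath {ι : Type} (Arr : ι → ι → Type) : ι → ι → Type
  | nil (i : ι) : QPath Arr i i
  | cons {i j k : ι} (a : Arr i j) (p : QPath Arr j k) : QPath Arr i k

namespace QPath

variable {ι : Type} {Arr : ι → ι → Type}

/-- The list of visited vertices. -/
def verts : ∀ {i j : ι}, QPath Arr i j → List ι
  | i, _, .nil _ => [i]
  | i, _, .cons _ p => i :: p.verts

/-- Evaluation of a path in the algebra `Λ` (trivial path at `i` ↦ `e i`). -/
def eval {Λ : Type} [Ring Λ] (e : ι → Λ) (arr : ∀ i j, Arr i j → Λ) :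
    ∀ {i j : ι}, QPath Arr i j → Λ
  | _, _, .nil i => e i
  | _, _, .cons a p => arr _ _ a * p.eval e arr

def append : ∀ {i j k : ι}, QPath Arr i j → QPath Arr j k → QPath Arr i k
  | _, _, _, .nil _, q => q
  | _, _, _, .cons a p, q => .cons a (p.append q)

def single {i j : ι} (a : Arr i j) : QPath Arr i j := .cons a (.nil j)

end QPath

/-- The condition `xΛe_j = e_iΛe_j = e_iΛx ≠ 0` on an element `x` of `e_iΛe_j`. -/
def Gcond (ei ej x : Λ) : Prop :=
  (Set.range fun b => x * b * ej) = (Set.range fun b => ei * b * ej) ∧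
  (Set.range fun b => ei * b * x) = (Set.range fun b => ei * b * ej) ∧
  ∃ b, ei * b * ej ≠ 0

/-- `w ∈ G(Q, I)` : `w` contains no cycle as a subpath (equivalently, visits no
vertex twice) and `wΛe_j = e_iΛe_j = e_iΛw ≠ 0`. -/
def GMem (e : ι → Λ) {Arr : ι → ι → Type} (arr : ∀ i j, Arr i j → Λ) {i j : ι}
    (w : QPath Arr i j) : Prop :=
  w.verts.Nodup ∧ Gcond Λ (e i) (e j) (w.eval e arr)

/-- Condition 1 for a bound quiver: if `e_iΛe_j ≠ 0` then `G^i_j ≠ ∅`. -/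
def Cond1 (e : ι → Λ) {Arr : ι → ι → Type} (arr : ∀ i j, Arr i j → Λ) : Prop :=
  ∀ i j : ι, (∃ x, e i * x * e j ≠ 0) → ∃ w : QPath Arr i j, GMem Λ e arr w

/-- Ring-level version of Condition 1 (Lemma `eqcd` (iii)). -/
def Cond1R : Prop :=
  ∀ x y : Λ, IsPrimIdem Λ x → IsPrimIdem Λ y → x * y = 0 → y * x = 0 →
    ∃ w : Λ, (∃ b, w = x * b * y) ∧
      (Set.range fun b => w * b * y) = (Set.range fun b => x * b * y) ∧
      (Set.range fun b => x * b * w) = (Set.range fun b => x * b * y)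

/-- `(e, Arr, arr)` presents `Λ` as the bound quiver algebra `KQ/I` with `Q` its
Gabriel quiver: `e` is a complete family of orthogonal primitive idempotents,
`Λ` is basic, each arrow `a : i → j` is sent to an element of `e_i (rad Λ) e_j`,
and the arrows form a `K`-basis of `rad Λ / rad² Λ`. -/
def IsGabrielPres (K : Type) [Field K] [Algebra K Λ] [DecidableEq ι] (e : ι → Λ)
    (Arr : ι → ι → Type) [∀ i j, Fintype (Arr i j)] (arr : ∀ i j, Arr i j → Λ) : Prop :=
  CompletePrimIdems Λ e ∧ IsBasicAlg Λ e ∧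
  (∀ i j (a : Arr i j), arr i j a ∈ radK K Λ ∧ e i * arr i j a * e j = arr i j a) ∧
  (radK K Λ ≤
    Submodule.span K (Set.range fun p : Σ i : ι, Σ j : ι, Arr i j => arr p.1 p.2.1 p.2.2) ⊔
      radK K Λ * radK K Λ) ∧
  (∀ c : (Σ i : ι, Σ j : ι, Arr i j) → K,
    (∑ p : Σ i : ι, Σ j : ι, Arr i j, c p • arr p.1 p.2.1 p.2.2) ∈ radK K Λ * radK K Λ →
    ∀ p, c p = 0)

/-! ### Partitions of a quiver, Condition 2 -/

/-- `x` and `y` are adjacent within the vertex subset `S` (undirected). -/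
def AdjIn {ι : Type} (Arr : ι → ι → Type) (S : Set ι) (x y : ι) : Prop :=
  x ∈ S ∧ y ∈ S ∧ (Nonempty (Arr x y) ∨ Nonempty (Arr y x))

/-- The full subquiver on `S` is connected. -/
def ConnectedOn {ι : Type} (Arr : ι → ι → Type) (S : Set ι) : Prop :=
  ∀ x ∈ S, ∀ y ∈ S, Relation.ReflTransGen (AdjIn Arr S) x y

/-- Adjacency of parts in the quotient quiver `Q^μ`. -/
def PartAdj {ι : Type} (Arr : ι → ι → Type) {ℓ : ℕ} (μ : ι → Fin ℓ) (u v : Fin ℓ) : Prop :=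
  u ≠ v ∧ ∃ x y, μ x = u ∧ μ y = v ∧ (Nonempty (Arr x y) ∨ Nonempty (Arr y x))

/-- Condition 2: there is a partition `μ` of `Q₀` into connected full subquivers
such that `Q^μ` is a tree (connected with `#arrows = #parts - 1`) and each
`sτtilt Λ^{a,b}_μ` — identified with the subposet of `sτtilt Λ` of modules
supported on the union of the two parts — is a lattice. -/
def Cond2 (e : ι → Λ) (Arr : ι → ι → Type) [∀ i j, Fintype (Arr i j)] : Prop :=
  ∃ (ℓ : ℕ) (μ : ι → Fin ℓ), Function.Surjective μ ∧
    (∀ a : Fin ℓ, ConnectedOn Arr {i | μ i = a}) ∧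
    (∀ u v : Fin ℓ, Relation.ReflTransGen (PartAdj Arr μ) u v) ∧
    Nat.card {p : Σ i : ι, Σ j : ι, Arr i j // μ p.1 ≠ μ p.2.1} = ℓ - 1 ∧
    ∀ a b : Fin ℓ, a ≠ b →
      IsLatticeP (fun T : Mdl Λᵐᵒᵖ => IsBSTT Λ e T ∧ Supp Λ e T ⊆ {i | μ i = a ∨ μ i = b})

/-! ### Correspondence of paths under a quiver isomorphism, and `∼` -/

/-- Transport of paths along a quiver isomorphism `σ : Q° → (Q')°` (defined on
non-loop arrows). -/
inductive PathCorr {ι ι' : Type} {Arr : ι → ι → Type} {Arr' : ι' → ι' → Type}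
    (σ : ι → ι') (σ1 : ∀ i j, i ≠ j → Arr i j → Arr' (σ i) (σ j)) :
    ∀ {i j : ι}, QPath Arr i j → QPath Arr' (σ i) (σ j) → Prop
  | nil (i : ι) : PathCorr σ σ1 (QPath.nil i) (QPath.nil (σ i))
  | cons {i j k : ι} (h : i ≠ j) (a : Arr i j) {p : QPath Arr j k}
      {p' : QPath Arr' (σ j) (σ k)} :
      PathCorr σ σ1 p p' → PathCorr σ σ1 (QPath.cons a p) (QPath.cons (σ1 i j h a) p')

/-- The relation `(Q, I) ∼ (Q', I')`: there is a quiver isomorphism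
`σ : Q° → (Q')°` with (a) `supp(e_{σ(i)}Γ) = σ(supp(e_iΛ))` and (b) `G(Γ) = σ(G(Λ))`. -/
def SimCond {Λ Γ : Type} [Ring Λ] [Ring Γ] {ι ι' : Type}
    (e : ι → Λ) {Arr : ι → ι → Type} (arr : ∀ i j, Arr i j → Λ)
    (f : ι' → Γ) {Arr' : ι' → ι' → Type} (arr' : ∀ i j, Arr' i j → Γ) : Prop :=
  ∃ (σ : ι ≃ ι') (σ1 : ∀ i j, i ≠ j → (Arr i j ≃ Arr' (σ i) (σ j))),
    (∀ i j : ι, (∃ x, e i * x * e j ≠ 0) ↔ ∃ y, f (σ i) * y * f (σ j) ≠ 0) ∧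
    (∀ (i j : ι) (w : QPath Arr i j), GMem Λ e arr w →
      ∃ w' : QPath Arr' (σ i) (σ j),
        PathCorr σ (fun i j h => σ1 i j h) w w' ∧ GMem Γ f arr' w') ∧
    (∀ (i j : ι) (w' : QPath Arr' (σ i) (σ j)), GMem Γ f arr' w' →
      ∃ w : QPath Arr i j,
        PathCorr σ (fun i j h => σ1 i j h) w w' ∧ GMem Λ e arr w)

end TauTilting

namespace TauTilting

/-- A complete family of orthogonal idempotents whose corner rings are local with nilpotent
radical, and whose indecomposable projectives are pairwise non-isomorphic. -/
structure BasicIdems {R ι : Type} [Ring R] [Fintype ι] (ε : ι → R) : Prop where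
  orth : ∀ i j, i ≠ j → ε i * ε j = 0
  idem : ∀ i, ε i * ε i = ε i
  sum_eq_one : ∑ i, ε i = 1
  ne_zero : ∀ i, ε i ≠ 0
  nilpotent_or_unit : ∀ i a, ε i * a * ε i = a →
    IsNilpotent a ∨ ∃ b, ε i * b * ε i = b ∧ a * b = ε i ∧ b * a = ε i
  basic : ∀ i j, i ≠ j → ∀ x y, ε i * x * ε j * y * ε i ≠ ε i

section Corner

variable {Λ : Type} [Ring Λ]

/-- Fitting's lemma in the corner ring of a primitive idempotent. -/
theorem IsPrimIdem.nilpotent_or_unit (K : Type) [Field K] [Algebra K Λ] [FiniteDimensional K Λ]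
    {e : Λ} (he : IsPrimIdem Λ e) {a : Λ} (ha : e * a * e = a) :
    IsNilpotent a ∨ ∃ b, e * b * e = b ∧ a * b = e ∧ b * a = e := by
  obtain ⟨hee, he0, hprim⟩ := he
  have hea : e * a = a := by
    rw [← ha]; simp only [← mul_assoc, hee.eq]
  have hae : a * e = a := by
    rw [← ha]; simp only [mul_assoc, hee.eq]
  set p : Polynomial K := Polynomial.X * minpoly K a with hp
  have hp0 : p ≠ 0 := mul_ne_zero Polynomial.X_ne_zero
    (minpoly.ne_zero (Algebra.IsIntegral.isIntegral a))
  have hpa : Polynomial.aeval a p = 0 := by simp [hp]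
  obtain ⟨q, hq, hdvd⟩ := Polynomial.exists_eq_pow_rootMultiplicity_mul_and_not_dvd p hp0 0
  set n := Polynomial.rootMultiplicity 0 p
  simp only [map_zero, sub_zero] at hq hdvd
  have hn : n ≠ 0 := by
    have : 0 < n := (Polynomial.rootMultiplicity_pos hp0).2 (by simp [hp])
    omega
  obtain ⟨m, hm⟩ := Nat.exists_eq_succ_of_ne_zero hn
  have hco : IsCoprime (Polynomial.X ^ n) q :=
    IsCoprime.pow_left ((Polynomial.irreducible_X.coprime_iff_not_dvd).2 hdvd)
  obtain ⟨s, t, hst⟩ := hco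
  set S := Polynomial.aeval a s with hS
  set T := Polynomial.aeval a (t * q) with hT
  have hcomm : ∀ r : Polynomial K, Polynomial.aeval a r * a = a * Polynomial.aeval a r := by
    intro r
    have := congrArg (Polynomial.aeval a) (mul_comm r Polynomial.X)
    simpa using this
  have hcomm' : ∀ (r : Polynomial K) (k : ℕ),
      Polynomial.aeval a r * a ^ k = a ^ k * Polynomial.aeval a r := fun r k =>
    (Commute.pow_right (hcomm r) k).eq
  have h1 : S * a ^ n + T = 1 := by
    have := congrArg (Polynomial.aeval a) hst
    simpa [hS, hT] using this
  have hTn : a ^ n * T = 0 := by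
    have : Polynomial.X ^ n * (t * q) = t * p := by rw [hq]; ring
    have := congrArg (Polynomial.aeval a) this
    simpa [hpa, hT] using this
  have hnT : T * a ^ n = 0 := by rw [hT, hcomm', ← hT, hTn]
  have hean : e * a ^ n = a ^ n := by rw [hm, pow_succ', ← mul_assoc, hea]
  have hane : a ^ n * e = a ^ n := by rw [hm, pow_succ, mul_assoc, hae]
  set E := S * a ^ n with hE
  have hE' : E = a ^ n * S := by rw [hE, hS, hcomm']
  have hEe : E * e = E := by rw [hE, mul_assoc, hane]
  have heE : e * E = E := by rw [hE', ← mul_assoc, hean]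
  have hTeq : T = 1 - E := eq_sub_of_add_eq' h1
  have hEE : E * E = E := by
    have : E * T = 0 := by rw [hE, mul_assoc, hTn, mul_zero]
    rw [hTeq, mul_sub, mul_one, sub_eq_zero] at this
    exact this.symm
  have hidem : IsIdempotentElem (e - E) := by
    simp [IsIdempotentElem, mul_sub, sub_mul, hEe, heE, hEE, hee.eq]
  rcases hprim E (e - E) hEE hidem (by simp [mul_sub, hEe, hEE]) (by simp [sub_mul, heE, hEE])
    (by simp) with h | h
  · left
    refine ⟨n, ?_⟩
    rw [hTeq, h, sub_zero, mul_one] at hTn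
    exact hTn
  · right
    have hEe' : E = e := (sub_eq_zero.1 h).symm
    have hb1 : a * (a ^ m * S) = e := by rw [← mul_assoc, ← pow_succ', ← hEe', hE', hm]
    have hb2 : (a ^ m * S) * a = e := by
      rw [mul_assoc, hS, hcomm, ← mul_assoc, ← pow_succ, ← hEe', hE', hm]
    refine ⟨e * (a ^ m * S) * e, ?_, ?_, ?_⟩
    · simp only [← mul_assoc, hee.eq]
      simp only [mul_assoc, hee.eq]
    · calc a * (e * (a ^ m * S) * e) = (a * e) * (a ^ m * S) * e := by simp only [mul_assoc]
        _ = e := by rw [hae, hb1, hee.eq]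
    · calc e * (a ^ m * S) * e * a = e * ((a ^ m * S) * (e * a)) := by simp only [mul_assoc]
        _ = e := by rw [hea, hb2, hee.eq]

theorem basicIdems_op {ι : Type} [Fintype ι] (K : Type) [Field K] [Algebra K Λ]
    [FiniteDimensional K Λ] {e : ι → Λ}
    (he : CompletePrimIdems Λ e) (hb : IsBasicAlg Λ e) : BasicIdems (fun i => op (e i)) where
  orth i j hij := by rw [← op_mul, he.2.1 hij.symm, op_zero]
  idem i := by rw [← op_mul, (he.1 i).1.eq]
  sum_eq_one := by
    have := congrArg op he.2.2
    simpa using this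
  ne_zero i := by simpa using (he.1 i).2.1
  nilpotent_or_unit i a ha := by
    have ha' : e i * unop a * e i = unop a := by
      have := congrArg unop ha
      simpa [mul_assoc] using this
    rcases (he.1 i).nilpotent_or_unit K ha' with ⟨n, hn⟩ | ⟨b, h1, h2, h3⟩
    · exact Or.inl ⟨n, unop_injective (by simpa using hn)⟩
    · refine Or.inr ⟨op b, ?_, ?_, ?_⟩
      · rw [← op_mul, ← op_mul, ← mul_assoc, h1]
      · exact unop_injective (by simpa using h3)
      · exact unop_injective (by simpa using h2)
  basic i j hij x y hxy := by
    have hi := (he.1 i).1.eq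
    have hj := (he.1 j).1.eq
    obtain ⟨x, rfl⟩ := op_surjective x
    obtain ⟨y, rfl⟩ := op_surjective y
    have h : (e i * y * e j) * (e j * x * e i) = e i := by
      have := congrArg unop hxy
      simp only [unop_mul, unop_op] at this
      calc _ = e i * y * (e j * e j) * x * e i := by simp only [mul_assoc]
        _ = _ := by rw [hj]; simpa only [mul_assoc] using this
    set X := e i * y * e j with hX
    set Y := e j * x * e i with hY
    have hXj : X * e j = X := by simp only [hX, mul_assoc, hj]
    have hjY : e j * Y = Y := by simp only [hY, ← mul_assoc, hj]
    have hYi : Y * e i = Y := by simp only [hY, mul_assoc, hi]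
    have hiX : e i * X = X := by simp only [hX, ← mul_assoc, hi]
    have hYX : Y * X = e j := by
      have hid : IsIdempotentElem (Y * X) := by
        rw [IsIdempotentElem, mul_assoc, ← mul_assoc X, h, hiX]
      have hjYX : e j * (Y * X) = Y * X := by rw [← mul_assoc, hjY]
      have hYXj : (Y * X) * e j = Y * X := by rw [mul_assoc, hXj]
      have hid2 : IsIdempotentElem (e j - Y * X) := by
        simp [IsIdempotentElem, mul_sub, sub_mul, hjYX, hYXj, hid.eq, hj]
      rcases (he.1 j).2.2 _ _ hid hid2 (by simp [mul_sub, hYXj, hid.eq])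
        (by simp [sub_mul, hjYX, hid.eq]) (by simp) with h0 | h0
      · exfalso
        apply (he.1 i).2.1
        calc e i = (X * Y) * (X * Y) := by rw [h, hi]
          _ = X * (Y * X) * Y := by simp only [mul_assoc]
          _ = 0 := by rw [h0]; simp
      · exact (sub_eq_zero.1 h0).symm
    let mulL : Λ → Λ →ₗ[Λᵐᵒᵖ] Λ := fun z =>
      { toFun := fun w => z * w
        map_add' := fun a b => mul_add z a b
        map_smul' := fun r a => by simp [mul_assoc] }
    have key : ∀ (k l : ι) (z : Λ), z * e k = z →
        rSpan Λ {1 - e k} ≤ (rSpan Λ {1 - e l}).comap (mulL z) := by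
      intro k l z hz
      refine Submodule.span_le.2 ?_
      rintro _ rfl
      have : mulL z (1 - e k) = 0 := by simp [mulL, mul_sub, hz]
      rw [SetLike.mem_coe, Submodule.mem_comap, this]
      exact Submodule.zero_mem _
    have key2 : ∀ (k : ι) (w : Λ), (e k * w) - w ∈ rSpan Λ {1 - e k} := by
      intro k w
      have : e k * w - w = op (-w) • (1 - e k) := by simp [sub_mul]
      rw [this]
      exact Submodule.smul_mem _ _ (Submodule.subset_span rfl)
    refine (hb i j hij).false (LinearEquiv.ofLinearMap (Submodule.mapQ _ _ (mulL Y) (key i j Y hYi))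
      (Submodule.mapQ _ _ (mulL X) (key j i X hXj)) ?_ ?_)
    · refine LinearMap.ext fun w => ?_
      obtain ⟨w, rfl⟩ := Submodule.mkQ_surjective _ w
      refine (Submodule.Quotient.eq (rSpan Λ {1 - e j})).2 ?_
      have : mulL Y (mulL X w) = e j * w := by simp [mulL, ← mul_assoc, hYX]
      rw [this]; exact key2 j w
    · refine LinearMap.ext fun w => ?_
      obtain ⟨w, rfl⟩ := Submodule.mkQ_surjective _ w
      refine (Submodule.Quotient.eq (rSpan Λ {1 - e i})).2 ?_
      have : mulL X (mulL Y w) = e i * w := by simp [mulL, ← mul_assoc, h]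
      rw [this]; exact key2 i w

end Corner

section Simple

variable {R ι : Type} [Ring R] [Fintype ι] {ε : ι → R}

theorem exists_isSimpleModule_quotient (R : Type) [Ring R] (M : Type) [AddCommGroup M]
    [Module R M] [Module.Finite R M] [Nontrivial M] :
    ∃ N : Submodule R M, IsSimpleModule R (M ⧸ N) := by
  rcases eq_top_or_exists_le_coatom (⊥ : Submodule R M) with h | ⟨N, hN, -⟩
  · exact absurd h bot_ne_top
  · exact ⟨N, isSimpleModule_iff_isCoatom.2 hN⟩

theorem exists_smul_eq_of_isSimpleModule {M : Type} [AddCommGroup M] [Module R M]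
    [IsSimpleModule R M] {x : M} (hx : x ≠ 0) (y : M) : ∃ r : R, r • x = y := by
  simpa using IsSimpleModule.toSpanSingleton_surjective R hx y

namespace BasicIdems

variable (h : BasicIdems ε) {M : Type} [AddCommGroup M] [Module R M]
include h

theorem exists_smul_ne_zero {x : M} (hx : x ≠ 0) : ∃ k, ε k • x ≠ 0 := by
  by_contra! hc
  apply hx
  rw [← one_smul R x, ← h.sum_eq_one, Finset.sum_smul]
  exact Finset.sum_eq_zero fun k _ => hc k

theorem smul_smul_self (i : ι) (x : M) : ε i • ε i • x = ε i • x := by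
  rw [smul_smul, h.idem]

theorem isNilpotent_through {k l : ι} (hkl : k ≠ l) (x y : R) :
    IsNilpotent (ε k * x * ε l * y * ε k) := by
  rcases h.nilpotent_or_unit k (ε k * x * ε l * y * ε k) (by
    simp only [← mul_assoc, h.idem]; simp only [mul_assoc, h.idem]) with hn | ⟨b, h1, -, h3⟩
  · exact hn
  · exfalso
    apply h.basic k l hkl (b * ε k * x) y
    calc _ = ε k * (b * (ε k * x * ε l * y * ε k)) := by simp only [mul_assoc]
      _ = ε k := by rw [h3, h.idem]

theorem smul_eq_zero_of_isNilpotent [IsSimpleModule R M] {i : ι} {r : R} (hr : IsNilpotent r)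
    (hri : ε i * r * ε i = r) {n : M} (hn : ε i • n = n) : r • n = 0 := by
  by_contra hne
  obtain ⟨b, hb⟩ := exists_smul_eq_of_isSimpleModule (R := R) hne n
  have hir : ε i * r = r := by rw [← hri]; simp only [← mul_assoc, h.idem]
  have hbr : (ε i * b * r) • n = n := by
    rw [mul_smul, mul_smul, hb, hn]
  have hn0 : n ≠ 0 := by rintro rfl; simp at hne
  rcases h.nilpotent_or_unit i (ε i * b * r) (by
    have hri' : r * ε i = r := by rw [← hri]; simp only [mul_assoc, h.idem]
    simp only [← mul_assoc, h.idem]; simp only [mul_assoc, hri']) with ⟨t, ht⟩ | ⟨c, h1, -, h3⟩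
  · have : ∀ t : ℕ, (ε i * b * r) ^ t • n = n := by
      intro t
      induction t with
      | zero => simp
      | succ t ih => rw [pow_succ, mul_smul, hbr, ih]
    exact hn0 (by rw [← this t, ht, zero_smul])
  · obtain ⟨t, ht⟩ := hr
    have key : ∀ y : M, ε i • y = y → r • y = 0 → y = 0 := by
      intro y hy hry
      rw [← hy, ← h3, mul_smul, mul_smul, hry, smul_zero, smul_zero]
    have : ∀ (t : ℕ) (y : M), ε i • y = y → r ^ t • y = 0 → y = 0 := by
      intro t
      induction t with
      | zero => intro y _ hy; simpa using hy
      | succ t ih =>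
        intro y hy hty
        refine key y hy (ih _ ?_ ?_)
        · rw [smul_smul, hir]
        · rw [smul_smul, ← pow_succ, hty]
    exact hn0 (this t n hn (by rw [ht, zero_smul]))

theorem smul_eq_zero_of_ne [IsSimpleModule R M] {k l : ι} (hkl : k ≠ l) {n : M} (hn : n ≠ 0)
    (hkn : ε k • n = n) (y : M) : ε l • y = 0 := by
  by_contra hne
  obtain ⟨x, hx⟩ := exists_smul_eq_of_isSimpleModule (R := R) hne n
  obtain ⟨z, hz⟩ := exists_smul_eq_of_isSimpleModule (R := R) hn y
  obtain ⟨t, ht⟩ := h.isNilpotent_through hkl x z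
  have h1 : (ε k * x * ε l * z * ε k) • n = n := by
    simp only [mul_smul, hkn, hz, hx]
  have : ∀ t : ℕ, (ε k * x * ε l * z * ε k) ^ t • n = n := by
    intro t
    induction t with
    | zero => simp
    | succ t ih => rw [pow_succ, mul_smul, h1, ih]
  exact hn (by rw [← this t, ht, zero_smul])

theorem exists_simple (i : ι) : ∃ N : Submodule R R, IsSimpleModule R (R ⧸ N) ∧
    ∃ n : R ⧸ N, n ≠ 0 ∧ ε i • n = n := by
  let P : Submodule R R := Submodule.span R {ε i}
  have : Nontrivial P := by
    refine ⟨⟨⟨ε i, Submodule.mem_span_singleton_self _⟩, 0, ?_⟩⟩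
    intro hc
    exact h.ne_zero i (congrArg Subtype.val hc)
  obtain ⟨N, hN⟩ := exists_isSimpleModule_quotient R P
  let f : R →ₗ[R] P ⧸ N := N.mkQ ∘ₗ LinearMap.toSpanSingleton R P
    ⟨ε i, Submodule.mem_span_singleton_self _⟩
  have hf : Function.Surjective f := by
    intro y
    obtain ⟨⟨y, hy⟩, rfl⟩ := N.mkQ_surjective y
    obtain ⟨r, rfl⟩ := Submodule.mem_span_singleton.1 hy
    exact ⟨r, rfl⟩
  let g := f.quotKerEquivOfSurjective hf
  have hsimple : IsSimpleModule R (R ⧸ LinearMap.ker f) := IsSimpleModule.congr g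
  refine ⟨LinearMap.ker f, hsimple, (LinearMap.ker f).mkQ (ε i), ?_, ?_⟩
  · intro hc
    have hfi : f (ε i) = 0 := by simpa using hc
    have hf1 : f 1 = 0 := by
      rw [← hfi]
      change N.mkQ _ = N.mkQ _
      congr 1
      ext
      simp [h.idem]
    have hf0 : f = 0 := by
      ext
      simpa using hf1
    have := IsSimpleModule.nontrivial R (P ⧸ N)
    obtain ⟨y, hy⟩ := exists_ne (0 : P ⧸ N)
    obtain ⟨r, rfl⟩ := hf y
    exact hy (LinearMap.congr_fun hf0 r)
  · rw [← map_smul, smul_eq_mul, h.idem]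

theorem exists_surjective_of_isSimpleModule {N : Type} [AddCommGroup N] [Module R N]
    [IsSimpleModule R M] [IsSimpleModule R N] {k : ι} {m : M} {n : N}
    (hm : m ≠ 0) (hkm : ε k • m = m) (hn : n ≠ 0) (hkn : ε k • n = n) :
    ∃ f : M →ₗ[R] N, Function.Surjective f := by
  have hker : LinearMap.ker (LinearMap.toSpanSingleton R M m) ≤
      LinearMap.ker (LinearMap.toSpanSingleton R N n) := by
    intro a ha
    simp only [LinearMap.mem_ker, LinearMap.toSpanSingleton_apply] at ha ⊢
    by_contra hne
    obtain ⟨b, hb⟩ := exists_smul_eq_of_isSimpleModule (R := R) hne n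
    have h1 : (ε k * (b * a) * ε k) • n = n := by simp only [mul_smul, hkn, hb]
    rcases h.nilpotent_or_unit k (ε k * (b * a) * ε k) (by
      simp only [← mul_assoc, h.idem]; simp only [mul_assoc, h.idem]) with hnil | ⟨c, -, -, h3⟩
    · apply hn
      rw [← h1]
      exact h.smul_eq_zero_of_isNilpotent hnil (by
        simp only [← mul_assoc, h.idem]; simp only [mul_assoc, h.idem]) hkn
    · apply hm
      rw [← hkm, ← h3]
      simp only [mul_smul, hkm, ha, smul_zero]
  let e := (LinearMap.toSpanSingleton R M m).quotKerEquivOfSurjective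
    (IsSimpleModule.toSpanSingleton_surjective R hm)
  refine ⟨(Submodule.liftQ _ _ hker) ∘ₗ e.symm.toLinearMap, ?_⟩
  rw [LinearMap.coe_comp]
  refine Function.Surjective.comp ?_ e.symm.surjective
  intro y
  obtain ⟨r, hr⟩ := IsSimpleModule.toSpanSingleton_surjective R hn y
  exact ⟨Submodule.Quotient.mk r, by simpa using hr⟩

end BasicIdems

end Simple

section Fac

variable {R : Type} [Ring R]

theorem memFac_of_fintype {M X : Mdl R} {α : Type} [Finite α] (f : (α → M) →ₗ[R] X)
    (hf : Function.Surjective f) : MemFac M X := by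
  obtain ⟨n, ⟨e⟩⟩ := Finite.exists_equiv_fin α
  refine ⟨n, f ∘ₗ (LinearEquiv.funCongrLeft R M e).toLinearMap, ?_⟩
  rw [LinearMap.coe_comp]
  exact hf.comp (LinearEquiv.surjective _)

theorem memFac_of_surjective {M X : Mdl R} (f : M →ₗ[R] X) (hf : Function.Surjective f) :
    MemFac M X := by
  refine memFac_of_fintype (α := Unit) (f ∘ₗ LinearMap.proj ()) ?_
  intro x
  obtain ⟨m, rfl⟩ := hf x
  exact ⟨fun _ => m, rfl⟩

theorem MemFac.refl (M : Mdl R) : MemFac M M :=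
  memFac_of_surjective LinearMap.id Function.surjective_id

theorem MemFac.map {M X Y : Mdl R} (hX : MemFac M X) (f : X →ₗ[R] Y)
    (hf : Function.Surjective f) : MemFac M Y := by
  obtain ⟨n, g, hg⟩ := hX
  exact ⟨n, f ∘ₗ g, by rw [LinearMap.coe_comp]; exact hf.comp hg⟩

theorem MemFac.trans {M X Y : Mdl R} (hX : MemFac M X) (hY : MemFac X Y) : MemFac M Y := by
  obtain ⟨n, f, hf⟩ := hX
  obtain ⟨m, g, hg⟩ := hY
  let F : (Fin m × Fin n → M) →ₗ[R] (Fin m → X) :=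
    LinearMap.pi fun a => f ∘ₗ LinearMap.funLeft R M (fun b => (a, b))
  refine memFac_of_fintype (g ∘ₗ F) ?_
  rw [LinearMap.coe_comp]
  refine hg.comp ?_
  intro x
  choose y hy using fun a => hf (x a)
  exact ⟨fun p => y p.1 p.2, funext fun a => hy a⟩

theorem facLE_iff {M N : Mdl R} : FacLE M N ↔ MemFac N M :=
  ⟨fun h => h M (MemFac.refl M), fun h _ hX => h.trans hX⟩

theorem FacLE.trans {L M N : Mdl R} (h : FacLE L M) (h' : FacLE M N) : FacLE L N :=
  fun X hX => h' X (h X hX)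

theorem MemFac.smul_eq_zero {M X : Mdl R} (hX : MemFac M X) {q : R}
    (hq : ∀ x : M, q • x = 0) (x : X) : q • x = 0 := by
  obtain ⟨n, f, hf⟩ := hX
  obtain ⟨y, rfl⟩ := hf x
  rw [← map_smul]
  have : q • y = 0 := by
    ext a
    simpa using hq (y a)
  rw [this, map_zero]

theorem Ext1Vanish.exists_lift {M X : Mdl R} (hMX : Ext1Vanish M X) {E T : Type}
    [AddCommGroup E] [Module R E] [AddCommGroup T] [Module R T] (f : X →ₗ[R] E) (g : E →ₗ[R] T)
    (hf : Function.Injective f) (hg : Function.Surjective g)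
    (hfg : LinearMap.range f = LinearMap.ker g) (φ : M →ₗ[R] T) :
    ∃ ψ : M →ₗ[R] E, g ∘ₗ ψ = φ := by
  have hgf : ∀ x, g (f x) = 0 := fun x => by
    rw [← LinearMap.mem_ker, ← hfg]; exact LinearMap.mem_range_self f x
  let P : Submodule R (M × E) :=
    LinearMap.ker (φ ∘ₗ LinearMap.fst R M E - g ∘ₗ LinearMap.snd R M E)
  have hP : ∀ p : M × E, p ∈ P ↔ φ p.1 = g p.2 := by
    intro p; simp [P, sub_eq_zero]
  let i : X →ₗ[R] P := LinearMap.codRestrict P (LinearMap.inr R M E ∘ₗ f) (by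
    intro c
    rw [hP]
    simp [hgf])
  let p : P →ₗ[R] M := LinearMap.fst R M E ∘ₗ P.subtype
  obtain ⟨s, hs⟩ := hMX (ModuleCat.of R P) i p
    (by
      intro a b hab
      exact hf (congrArg (fun z : P => (z : M × E).2) hab))
    (by
      intro t
      obtain ⟨m, hm⟩ := hg (φ t)
      exact ⟨⟨(t, m), (hP _).2 hm.symm⟩, rfl⟩)
    (by
      ext z
      constructor
      · rintro ⟨y, rfl⟩
        rfl
      · intro hz
        have hz1 : (z : M × E).1 = 0 := hz
        have hz2 := (hP z).1 z.2
        rw [hz1, map_zero] at hz2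
        have hz3 : (z : M × E).2 ∈ LinearMap.range f := by rw [hfg]; exact hz2.symm
        obtain ⟨y, hy⟩ := hz3
        exact ⟨y, Subtype.ext (Prod.ext hz1.symm hy)⟩)
  refine ⟨LinearMap.snd R M E ∘ₗ P.subtype ∘ₗ s, ?_⟩
  ext t
  have h1 : (s t : M × E).1 = t := LinearMap.congr_fun hs t
  have h2 := (hP _).1 (s t).2
  rw [h1] at h2
  exact h2.symm

/-- `Fac T` is closed under extensions when `T` is τ-rigid. -/
theorem IsTauRigid.memFac_of_extension {T : Mdl R} (hT : IsTauRigid T) {M : Type}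
    [AddCommGroup M] [Module R M] (N : Submodule R M)
    (hN : MemFac T (ModuleCat.of R N)) (hQ : MemFac T (ModuleCat.of R (M ⧸ N))) :
    MemFac T (ModuleCat.of R M) := by
  have lift : ∀ g : T →ₗ[R] M ⧸ N, ∃ g' : T →ₗ[R] M, N.mkQ ∘ₗ g' = g :=
    (hT.2 _ hN).exists_lift N.subtype N.mkQ N.injective_subtype N.mkQ_surjective
      (by rw [N.range_subtype, N.ker_mkQ])
  obtain ⟨n, f, hf⟩ := hQ
  obtain ⟨n', f', hf'⟩ := hN
  choose g hg using fun a : Fin n => lift (f ∘ₗ LinearMap.single R (fun _ => (T : Type)) a)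
  let F : (Fin n → T) →ₗ[R] M := ∑ a, g a ∘ₗ LinearMap.proj a
  have hF : N.mkQ ∘ₗ F = f := by
    apply LinearMap.pi_ext'
    intro a
    rw [← hg a]
    ext t
    simp only [F, LinearMap.comp_apply, LinearMap.sum_apply, LinearMap.proj_apply,
      LinearMap.single_apply]
    congr 1
    rw [Finset.sum_eq_single a]
    · simp
    · intro b _ hb; simp [hb]
    · simp
  let G : (Fin n ⊕ Fin n' → T) →ₗ[R] M :=
    F ∘ₗ LinearMap.funLeft R T Sum.inl +
      (N.subtype ∘ₗ f') ∘ₗ LinearMap.funLeft R T Sum.inr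
  refine memFac_of_fintype (X := ModuleCat.of R M) G ?_
  intro m
  obtain ⟨x, hx⟩ := hf (N.mkQ m)
  have hd : m - F x ∈ N := by
    rw [← Submodule.Quotient.mk_eq_zero, ← Submodule.mkQ_apply, map_sub, sub_eq_zero, ← hx, ← hF]
    rfl
  obtain ⟨y, hy⟩ := hf' ⟨_, hd⟩
  refine ⟨Sum.elim x y, ?_⟩
  change F x + ((f' y : N) : M) = m
  rw [hy]
  simp

theorem IsTauRigid.memFac_of_simples {T : Mdl R} (hT : IsTauRigid T) {q : R}
    (hs : ∀ N : Mdl R, IsSimpleModule R N → (∀ x : N, q • x = 0) → MemFac T N)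
    {M : Type} [AddCommGroup M] [Module R M] (hM : IsFiniteLength R M)
    (hq : ∀ x : M, q • x = 0) : MemFac T (ModuleCat.of R M) := by
  induction hM with
  | @of_subsingleton M _ _ _ =>
    exact ⟨0, 0, fun x => ⟨0, Subsingleton.elim (α := M) _ _⟩⟩
  | @of_simple_quotient M _ _ N _ _ ih =>
    refine hT.memFac_of_extension N (ih fun x => Subtype.ext (hq x)) ?_
    refine hs (ModuleCat.of R (M ⧸ N)) inferInstance fun x => ?_
    obtain ⟨x, rfl⟩ := N.mkQ_surjective x
    rw [← map_smul, hq, map_zero]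

theorem isFiniteLength_of_finite [IsArtinianRing R] (M : Type) [AddCommGroup M] [Module R M]
    [Module.Finite R M] : IsFiniteLength R M :=
  isFiniteLength_iff_isNoetherian_isArtinian.2 ⟨inferInstance, inferInstance⟩

end Fac

section Pres

variable {R : Type} [Ring R]

/-- The two-sided ideal generated by `q`, as a left ideal. -/
def kill (q : R) : Submodule R R := Submodule.span R {x | ∃ r, x = q * r}

theorem mul_mem_kill (q r : R) : q * r ∈ kill q := Submodule.subset_span ⟨r, rfl⟩

theorem kill_mul_left {q a : R} (r : R) (ha : a ∈ kill q) : r * a ∈ kill q :=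
  (kill q).smul_mem r ha

theorem kill_mul_right {q a : R} (ha : a ∈ kill q) (r : R) : a * r ∈ kill q := by
  have : kill q ≤ (kill q).comap (LinearMap.toSpanSingleton R R r) := by
    refine Submodule.span_le.2 ?_
    rintro _ ⟨s, rfl⟩
    simpa [mul_assoc] using mul_mem_kill q (s * r)
  exact this ha

theorem smul_eq_zero_of_mem_kill {M : Type} [AddCommGroup M] [Module R M] {q a : R}
    (hq : ∀ x : M, q • x = 0) (ha : a ∈ kill q) (x : M) : a • x = 0 := by
  have : kill q ≤ LinearMap.ker (LinearMap.toSpanSingleton R M x) := by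
    refine Submodule.span_le.2 ?_
    rintro _ ⟨s, rfl⟩
    simp [mul_smul, hq]
  exact this ha

variable (q p : R) {m : ℕ} (u : Fin m → R)

/-- The relations of `Pres q p u`. -/
def presSub : Submodule R (Fin m → R) where
  carrier := {r | ∃ w : R, ∀ a, r a * p - w * u a ∈ kill q}
  add_mem' := by
    rintro r s ⟨w, hw⟩ ⟨z, hz⟩
    refine ⟨w + z, fun a => ?_⟩
    have := (kill q).add_mem (hw a) (hz a)
    convert this using 1
    simp only [Pi.add_apply, add_mul]
    abel
  zero_mem' := ⟨0, fun a => by simp⟩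
  smul_mem' := by
    rintro c r ⟨w, hw⟩
    refine ⟨c * w, fun a => ?_⟩
    have := kill_mul_left c (hw a)
    simpa [mul_sub, mul_assoc] using this

/-- For an idempotent `p`, the module over `R / (q)` which is the cokernel of the map from `R` to
`(R p)ᵐ` given by `u`. -/
abbrev Pres : Type := (Fin m → R) ⧸ presSub q p u

namespace Pres

/-- The generators of `Pres q p u`. -/
def gen (a : Fin m) : Pres q p u := (presSub q p u).mkQ (Pi.single a 1)

variable {q p u}

theorem mkQ_eq_sum (r : Fin m → R) : (presSub q p u).mkQ r = ∑ a, r a • gen q p u a := by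
  simp only [gen, ← map_smul, ← map_sum]
  congr 1
  ext b
  simp [Finset.sum_apply, Pi.single_apply]

theorem exists_eq_sum (y : Pres q p u) : ∃ r : Fin m → R, y = ∑ a, r a • gen q p u a := by
  obtain ⟨r, rfl⟩ := (presSub q p u).mkQ_surjective y
  exact ⟨r, mkQ_eq_sum r⟩

theorem sum_eq_zero_iff (r : Fin m → R) :
    ∑ a, r a • gen q p u a = 0 ↔ ∃ w : R, ∀ a, r a * p - w * u a ∈ kill q := by
  rw [← mkQ_eq_sum, Submodule.mkQ_apply, Submodule.Quotient.mk_eq_zero]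
  rfl

theorem smul_eq_zero (y : Pres q p u) : q • y = 0 := by
  obtain ⟨r, rfl⟩ := exists_eq_sum y
  rw [Finset.smul_sum]
  simp only [smul_smul]
  rw [sum_eq_zero_iff]
  refine ⟨0, fun a => ?_⟩
  rw [zero_mul, sub_zero, mul_assoc]
  exact mul_mem_kill _ _

theorem sum_gen (hu : ∀ a, u a * p = u a) : ∑ a, u a • gen q p u a = 0 := by
  rw [sum_eq_zero_iff]
  exact ⟨1, fun a => by simp [hu]⟩

theorem smul_gen (hp : p * p = p) (a : Fin m) : p • gen q p u a = gen q p u a := by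
  rw [← sub_eq_zero, gen, ← map_smul, ← map_sub, Submodule.mkQ_apply,
    Submodule.Quotient.mk_eq_zero]
  refine ⟨0, fun b => ?_⟩
  by_cases hb : b = a
  · subst hb; simp [sub_mul, hp]
  · simp [hb]

theorem exists_eq_sum_corner (hp : p * p = p) {y : Pres q p u} (hy : p • y = y) :
    ∃ r : Fin m → R, (∀ a, p * r a * p = r a) ∧ y = ∑ a, r a • gen q p u a := by
  obtain ⟨r, hr⟩ := exists_eq_sum y
  refine ⟨fun a => p * r a * p, fun a => ?_, ?_⟩
  · simp only [← mul_assoc, hp]; simp only [mul_assoc, hp]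
  · simp only [mul_smul, smul_gen hp]
    rw [← Finset.smul_sum, ← hr, hy]

theorem hom_ext {M : Type} [AddCommGroup M] [Module R M] {f g : Pres q p u →ₗ[R] M}
    (h : ∀ a, f (gen q p u a) = g (gen q p u a)) : f = g := by
  refine LinearMap.ext fun y => ?_
  obtain ⟨r, rfl⟩ := exists_eq_sum y
  simp [map_sum, h]

theorem exists_lift {M : Type} [AddCommGroup M] [Module R M] (hq : ∀ x : M, q • x = 0)
    (x : Fin m → M) (hx : ∀ a, p • x a = x a) (hux : ∑ a, u a • x a = 0) :
    ∃ f : Pres q p u →ₗ[R] M, ∀ a, f (gen q p u a) = x a := by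
  let F : (Fin m → R) →ₗ[R] M := ∑ a, LinearMap.toSpanSingleton R M (x a) ∘ₗ LinearMap.proj a
  have hF : ∀ r, F r = ∑ a, r a • x a := fun r => by simp [F, LinearMap.sum_apply]
  refine ⟨(presSub q p u).liftQ F ?_, fun a => ?_⟩
  · rintro r ⟨w, hw⟩
    rw [LinearMap.mem_ker, hF]
    have : ∀ a, r a • x a = w • u a • x a := by
      intro a
      have h1 := smul_eq_zero_of_mem_kill hq (hw a) (x a)
      rw [sub_smul, sub_eq_zero, mul_smul, mul_smul, hx] at h1
      exact h1
    rw [Finset.sum_congr rfl fun a _ => this a, ← Finset.smul_sum, hux, smul_zero]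
  · rw [gen, ← LinearMap.comp_apply, Submodule.liftQ_mkQ, hF, Finset.sum_eq_single a]
    · simp
    · intro b _ hb; simp [hb]
    · simp

end Pres

end Pres

section Approx

variable {R ι : Type} [Ring R] [Fintype ι] {ε : ι → R}

open scoped Classical in
/-- The idempotent attached to a set of vertices. -/
noncomputable def idemOf (ε : ι → R) (V : Set ι) : R := ∑ v, if v ∈ V then ε v else 0

/-- `u` is a minimal left approximation `R p' → (R p)ᵐ` over `R / (q)`. -/
structure IsMinApprox (q p' p : R) {m : ℕ} (u : Fin m → R) : Prop where
  hom : ∀ a, p' * u a * p = u a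
  gens : ∀ x, ∃ r : Fin m → R, (∀ a, p * r a * p = r a) ∧ p' * x * p - ∑ a, u a * r a ∈ kill q
  min : ∀ r : Fin m → R, ∑ a, u a * r a ∈ kill q → ∀ a, IsNilpotent (p * r a * p)

namespace BasicIdems

variable (h : BasicIdems ε)
include h

theorem mul_idemOf (V : Set ι) (i : ι) [Decidable (i ∈ V)] :
    ε i * idemOf ε V = if i ∈ V then ε i else 0 := by
  classical
  rw [idemOf, Finset.mul_sum, Finset.sum_eq_single i]
  · by_cases hi : i ∈ V <;> simp [hi, h.idem]
  · intro j _ hj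
    by_cases hjV : j ∈ V <;> simp [hjV, h.orth i j hj.symm]
  · simp

theorem idemOf_mul_self (V : Set ι) : idemOf ε V * idemOf ε V = idemOf ε V := by
  classical
  conv_lhs => rw [idemOf, Finset.sum_mul]
  rw [idemOf]
  refine Finset.sum_congr rfl fun v _ => ?_
  split_ifs with hv
  · rw [← idemOf, h.mul_idemOf, if_pos hv]
  · rw [zero_mul]

theorem idemOf_smul_eq_zero_iff {M : Type} [AddCommGroup M] [Module R M] (V : Set ι) :
    (∀ x : M, idemOf ε V • x = 0) ↔ ∀ v ∈ V, ∀ x : M, ε v • x = 0 := by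
  classical
  constructor
  · intro hq v hv x
    have := h.mul_idemOf V v
    rw [if_pos hv] at this
    rw [← this, mul_smul, hq, smul_zero]
  · intro hv x
    rw [idemOf, Finset.sum_smul]
    refine Finset.sum_eq_zero fun v _ => ?_
    split_ifs with hvV
    · exact hv v hvV x
    · exact zero_smul _ _

theorem exists_isMinApprox (K : Type) [Field K] [Algebra K R] [FiniteDimensional K R]
    (q : R) (k i : ι) : ∃ (m : ℕ) (u : Fin m → R), IsMinApprox q (ε k) (ε i) u := by
  classical
  let P : ℕ → Prop := fun m => ∃ u : Fin m → R, (∀ a, ε k * u a * ε i = u a) ∧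
    ∀ x, ∃ r : Fin m → R, (∀ a, ε i * r a * ε i = r a) ∧ ε k * x * ε i - ∑ a, u a * r a ∈ kill q
  have hP : ∃ m, P m := by
    let b := Module.finBasis K R
    refine ⟨_, fun a => ε k * b a * ε i, fun a => ?_, fun x => ⟨fun a => b.repr x a • ε i, ?_, ?_⟩⟩
    · simp only [← mul_assoc, h.idem]; simp only [mul_assoc, h.idem]
    · intro a; simp [h.idem]
    · have : ε k * x * ε i - ∑ a, ε k * b a * ε i * b.repr x a • ε i = 0 := by
        conv_lhs => rw [← b.sum_repr x]
        rw [Finset.mul_sum, Finset.sum_mul, sub_eq_zero]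
        refine Finset.sum_congr rfl fun a _ => ?_
        simp [mul_assoc, h.idem]
      rw [this]
      exact zero_mem _
  obtain ⟨u, hu, hg⟩ := Nat.find_spec hP
  refine ⟨Nat.find hP, u, hu, hg, ?_⟩
  have hmin := fun m => Nat.find_min hP (m := m)
  generalize Nat.find hP = m at u hu hg hmin
  intro r hr a₀
  by_contra hnil
  obtain ⟨s, hs1, hs2, -⟩ := (h.nilpotent_or_unit i (ε i * r a₀ * ε i) (by
    simp only [← mul_assoc, h.idem]; simp only [mul_assoc, h.idem])).resolve_left hnil
  obtain ⟨n, rfl⟩ : ∃ n, m = n + 1 := ⟨m - 1, by have := a₀.pos; omega⟩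
  refine hmin n (Nat.lt_succ_self n) ⟨fun b => u (a₀.succAbove b), fun b => hu _, fun x => ?_⟩
  obtain ⟨t, ht, hxt⟩ := hg x
  have hui : ∀ a, u a * ε i = u a := fun a => by
    rw [← hu a]; simp only [mul_assoc, h.idem]
  refine ⟨fun b => t (a₀.succAbove b) - ε i * r (a₀.succAbove b) * ε i * s * t a₀, fun b => ?_, ?_⟩
  · have h1 : t a₀ * ε i = t a₀ := by rw [← ht]; simp only [mul_assoc, h.idem]
    simp only [mul_sub, sub_mul, ht, ← mul_assoc, h.idem]
    simp only [mul_assoc, h1]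
  · have key : u a₀ + ∑ b, u (a₀.succAbove b) * (ε i * r (a₀.succAbove b) * ε i * s) =
        (∑ a, u a * r a) * (ε i * s) := by
      rw [Fin.sum_univ_succAbove _ a₀, add_mul, Finset.sum_mul]
      congr 1
      · calc u a₀ = u a₀ * ε i := (hui _).symm
          _ = u a₀ * (ε i * r a₀ * ε i * s) := by rw [hs2]
          _ = (u a₀ * ε i) * (r a₀ * (ε i * s)) := by simp only [mul_assoc]
          _ = _ := by rw [hui, mul_assoc]
      · refine Finset.sum_congr rfl fun b _ => ?_
        calc _ = (u (a₀.succAbove b) * ε i) * (r (a₀.succAbove b) * (ε i * s)) := by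
              simp only [mul_assoc]
          _ = _ := by rw [hui, mul_assoc]
    have h2 := kill_mul_right (kill_mul_right hr (ε i * s)) (t a₀)
    rw [← key] at h2
    have h3 := (kill q).add_mem hxt h2
    convert h3 using 1
    rw [Fin.sum_univ_succAbove _ a₀]
    simp only [mul_sub, Finset.sum_sub_distrib, add_mul, Finset.sum_mul, mul_assoc]
    abel

end BasicIdems

end Approx

section Indec

variable {R ι : Type} [Ring R] [Fintype ι] {ε : ι → R}

theorem isIndec_of_idempotents {M : Mdl R} [Nontrivial M]
    (hM : ∀ φ : M →ₗ[R] M, φ ∘ₗ φ = φ → φ = 0 ∨ φ = LinearMap.id) : IsIndec M := by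
  refine ⟨inferInstance, fun N N' hc => ?_⟩
  rcases hM (N.projection N' hc) (Submodule.isIdempotentElem_projection hc) with h0 | h1
  · left
    rw [← Submodule.range_projection hc, h0, LinearMap.range_zero]
  · right
    rw [← Submodule.ker_projection hc, h1, LinearMap.ker_id]

namespace BasicIdems

variable (h : BasicIdems ε)
include h

theorem exists_simple_notMem {V : Set ι} {i : ι} (hi : i ∉ V) :
    ∃ N : Submodule R R, IsSimpleModule R (R ⧸ N) ∧ (∀ k ≠ i, ∀ y : R ⧸ N, ε k • y = 0) ∧
      (∀ y : R ⧸ N, idemOf ε V • y = 0) ∧ ∃ n : R ⧸ N, n ≠ 0 ∧ ε i • n = n := by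
  obtain ⟨N, hN, n, hn, hin⟩ := h.exists_simple i
  have hk : ∀ k ≠ i, ∀ y : R ⧸ N, ε k • y = 0 := fun k hk y => h.smul_eq_zero_of_ne hk.symm hn hin y
  refine ⟨N, hN, hk, ?_, n, hn, hin⟩
  rw [h.idemOf_smul_eq_zero_iff]
  exact fun v hv y => hk v (fun hvi => hi (hvi ▸ hv)) y

theorem pres_gen_ne_zero {V : Set ι} {i : ι} (hi : i ∉ V) {m : ℕ} {u : Fin m → R}
    (hu : u = 0 ∨ ∃ k ≠ i, ∀ a, ε k * u a = u a) (a : Fin m) :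
    Pres.gen (idemOf ε V) (ε i) u a ≠ 0 := by
  obtain ⟨N, hN, hk, hq, n, hn, hin⟩ := h.exists_simple_notMem hi
  obtain ⟨f, hf⟩ := Pres.exists_lift (u := u) hq (fun _ => n) (fun _ => hin) (by
    refine Finset.sum_eq_zero fun b _ => ?_
    rcases hu with rfl | ⟨k, hki, hu⟩
    · simp
    · rw [← hu, mul_smul, hk k hki])
  intro h0
  have := hf a
  rw [h0, map_zero] at this
  exact hn this.symm

theorem eq_zero_of_nilpotent_coeffs {q : R} {i : ι} {m : ℕ} {u : Fin m → R}
    {φ : Pres q (ε i) u →ₗ[R] Pres q (ε i) u} (hφ : φ ∘ₗ φ = φ) {r : Fin m → Fin m → R}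
    (hr : ∀ a, φ (Pres.gen q (ε i) u a) = ∑ b, r a b • Pres.gen q (ε i) u b)
    (hnil : ∀ a b, IsNilpotent (ε i * r a b * ε i)) : φ = 0 := by
  by_contra hne
  have : Nontrivial (LinearMap.range φ) := by
    rw [Submodule.nontrivial_iff_ne_bot]
    exact fun hb => hne (LinearMap.range_eq_bot.1 hb)
  obtain ⟨N, hN⟩ := exists_isSimpleModule_quotient R (LinearMap.range φ)
  set ψ := N.mkQ ∘ₗ φ.rangeRestrict with hψ
  have hψφ : ∀ x, ψ (φ x) = ψ x := by
    intro x
    have : φ.rangeRestrict (φ x) = φ.rangeRestrict x := Subtype.ext (LinearMap.congr_fun hφ x)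
    simp [hψ, this]
  have hψi : ∀ b, ε i • ψ (Pres.gen q (ε i) u b) = ψ (Pres.gen q (ε i) u b) := by
    intro b
    rw [← map_smul, Pres.smul_gen (h.idem i)]
  have hψ0 : ψ = 0 := by
    refine Pres.hom_ext fun a => ?_
    rw [← hψi, ← hψφ, hr, map_sum, Finset.smul_sum, LinearMap.zero_apply]
    refine Finset.sum_eq_zero fun b _ => ?_
    rw [map_smul, ← hψi, ← mul_smul, ← mul_smul]
    exact h.smul_eq_zero_of_isNilpotent (hnil a b)
      (by simp only [← mul_assoc, h.idem]; simp only [mul_assoc, h.idem]) (hψi b)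
  have hsurj : Function.Surjective ψ :=
    (N.mkQ_surjective).comp φ.surjective_rangeRestrict
  have := IsSimpleModule.nontrivial R (LinearMap.range φ ⧸ N)
  obtain ⟨y, hy⟩ := exists_ne (0 : LinearMap.range φ ⧸ N)
  obtain ⟨x, rfl⟩ := hsurj y
  exact hy (LinearMap.congr_fun hψ0 x)

theorem proj_idempotent {q : R} {i : ι} {φ : Pres q (ε i) (0 : Fin 1 → R) →ₗ[R] Pres q (ε i) 0}
    (hφ : φ ∘ₗ φ = φ) : φ = 0 ∨ φ = LinearMap.id := by
  obtain ⟨r, hr, hφr⟩ := Pres.exists_eq_sum_corner (h.idem i)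
    (y := φ (Pres.gen q (ε i) 0 0)) (by rw [← map_smul, Pres.smul_gen (h.idem i)])
  rcases h.nilpotent_or_unit i (r 0) (hr 0) with hnil | ⟨b, -, -, hb⟩
  · left
    refine h.eq_zero_of_nilpotent_coeffs hφ (r := fun _ => r) (fun a => ?_) (fun a b => ?_)
    · rw [Subsingleton.elim a 0, hφr]
    · rw [hr, Subsingleton.elim b 0]; exact hnil
  · right
    refine Pres.hom_ext fun a => ?_
    rw [Subsingleton.elim a 0, LinearMap.id_apply]
    simp only [Fin.sum_univ_one] at hφr
    have h1 : φ (b • Pres.gen q (ε i) 0 0) = Pres.gen q (ε i) 0 0 := by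
      rw [map_smul, hφr, smul_smul, hb, Pres.smul_gen (h.idem i)]
    rw [← h1]
    exact LinearMap.congr_fun hφ _

theorem proj_isEmpty_equiv {V : Set ι} {k l : ι} (hk : k ∉ V) (hkl : k ≠ l) :
    IsEmpty (Pres (idemOf ε V) (ε k) (0 : Fin 1 → R) ≃ₗ[R]
      Pres (idemOf ε V) (ε l) (0 : Fin 1 → R)) := by
  refine ⟨fun φ => h.pres_gen_ne_zero hk (Or.inl rfl) (0 : Fin 1) ?_⟩
  set c := Pres.gen (idemOf ε V) (ε k) (0 : Fin 1 → R) 0 with hc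
  set d := Pres.gen (idemOf ε V) (ε l) (0 : Fin 1 → R) 0 with hd
  have hkc : ε k • c = c := Pres.smul_gen (h.idem k) 0
  have hld : ε l • d = d := Pres.smul_gen (h.idem l) 0
  obtain ⟨x, hx⟩ := Pres.exists_eq_sum (φ c)
  obtain ⟨y, hy⟩ := Pres.exists_eq_sum (φ.symm d)
  simp only [Fin.sum_univ_one, ← hc, ← hd] at hx hy
  have h1 : (ε k * x 0 * ε l * y 0 * ε k) • c = c := by
    apply φ.injective
    simp only [mul_smul, hkc, map_smul]
    rw [← map_smul φ (y 0) c, ← hy, φ.apply_symm_apply, hld, ← hx, ← map_smul, hkc]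
  obtain ⟨t, ht⟩ := h.isNilpotent_through hkl (x 0) (y 0)
  have : ∀ t : ℕ, (ε k * x 0 * ε l * y 0 * ε k) ^ t • c = c := by
    intro t
    induction t with
    | zero => simp
    | succ t ih => rw [pow_succ, mul_smul, h1, ih]
  rw [← this t, ht, zero_smul]

end BasicIdems

end Indec

open Matrix

section MatrixOf

variable {R : Type} [Ring R] {q p : R} {m m' m'' : ℕ} {u : Fin m → R} {u' : Fin m' → R}
  {u'' : Fin m'' → R}

/-- The pair `(A, w)` represents `φ` on generators and on relations. -/
structure IsMatrixOf (φ : Pres q p u →ₗ[R] Pres q p u') (A : Matrix (Fin m) (Fin m') R)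
    (w : R) : Prop where
  corner : ∀ a b, p * A a b * p = A a b
  gen : ∀ a, φ (Pres.gen q p u a) = ∑ b, A a b • Pres.gen q p u' b
  rel : ∀ b, (u ᵥ* A) b - w * u' b ∈ kill q

theorem Pres.exists_isMatrixOf {k k' : R} (hp : p * p = p) (hu : ∀ a, k * u a * p = u a)
    (hk : k * k = k) (hk' : k' * k' = k') (hu' : ∀ a, k' * u' a * p = u' a)
    (φ : Pres q p u →ₗ[R] Pres q p u') :
    ∃ A w, k * w * k' = w ∧ IsMatrixOf φ A w := by
  have hpg : ∀ a, p • φ (gen q p u a) = φ (gen q p u a) := fun a => by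
    rw [← map_smul, smul_gen hp]
  choose A hA hφ using fun a => exists_eq_sum_corner hp (hpg a)
  have hup : ∀ a, u a * p = u a := fun a => by rw [← hu a, mul_assoc, hp]
  have hku : ∀ a, k * u a = u a := fun a => by rw [← hu a]; simp only [← mul_assoc, hk]
  have hku' : ∀ a, k' * u' a = u' a := fun a => by rw [← hu' a]; simp only [← mul_assoc, hk']
  have hAp : ∀ a b, A a b * p = A a b := fun a b => by rw [← hA a b, mul_assoc, hp]
  have h0 : ∑ b, (u ᵥ* (A : Matrix _ _ R)) b • gen q p u' b = 0 := by
    have h1 : φ (∑ a, u a • gen q p u a) = 0 := by rw [sum_gen hup, map_zero]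
    rw [← h1, map_sum]
    simp only [map_smul, hφ, Finset.smul_sum, smul_smul]
    rw [Finset.sum_comm]
    simp only [vecMul, dotProduct, Finset.sum_smul]
  obtain ⟨w, hw⟩ := (sum_eq_zero_iff _).1 h0
  refine ⟨A, k * w * k', by simp only [← mul_assoc, hk]; simp only [mul_assoc, hk'],
    hA, hφ, fun b => ?_⟩
  have h2 := kill_mul_left k (hw b)
  convert h2 using 1
  rw [mul_sub, mul_assoc (k * w), hku', mul_assoc]
  congr 1
  simp only [vecMul, dotProduct, Finset.sum_mul, Finset.mul_sum, mul_assoc, hAp]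
  simp only [← mul_assoc, hku]

namespace IsMatrixOf

theorem comp (hp : p * p = p) {φ : Pres q p u →ₗ[R] Pres q p u'}
    {ψ : Pres q p u' →ₗ[R] Pres q p u''}
    {A : Matrix (Fin m) (Fin m') R} {B : Matrix (Fin m') (Fin m'') R} {w w' : R}
    (hA : IsMatrixOf φ A w) (hB : IsMatrixOf ψ B w') :
    IsMatrixOf (ψ ∘ₗ φ) (A * B) (w * w') where
  corner a b := by
    have hpA : ∀ a b, p * A a b = A a b := fun a b => by
      rw [← hA.corner a b]; simp only [← mul_assoc, hp]
    have hBp : ∀ a b, B a b * p = B a b := fun a b => by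
      rw [← hB.corner a b]; simp only [mul_assoc, hp]
    simp only [mul_apply, Finset.mul_sum, Finset.sum_mul, ← mul_assoc, hpA]
    simp only [mul_assoc, hBp]
  gen a := by
    simp only [LinearMap.comp_apply, hA.gen, map_sum, map_smul, hB.gen, Finset.smul_sum, smul_smul,
      mul_apply, Finset.sum_smul]
    rw [Finset.sum_comm]
  rel c := by
    have h1 : ∑ b, ((u ᵥ* A) b - w * u' b) * B b c ∈ kill q :=
      Submodule.sum_mem _ fun b _ => kill_mul_right (hA.rel b) _
    have h2 := (kill q).add_mem h1 (kill_mul_left w (hB.rel c))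
    convert h2 using 1
    rw [← vecMul_vecMul]
    simp only [vecMul, dotProduct, sub_mul, Finset.sum_sub_distrib, mul_sub, Finset.mul_sum,
      mul_assoc]
    abel

theorem id (hp : p * p = p) {k : R} (hu : ∀ a, u a * p = u a) (hk : ∀ a, k * u a = u a) :
    IsMatrixOf (LinearMap.id : Pres q p u →ₗ[R] Pres q p u) (diagonal fun _ => p) k where
  corner a b := by by_cases hab : a = b <;> simp [hab, hp]
  gen a := by
    rw [Finset.sum_eq_single a]
    · simp [Pres.smul_gen hp]
    · intro b _ hb; simp [hb.symm]
    · simp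
  rel b := by simp [vecMul_diagonal, hu, hk]

theorem sub {φ ψ : Pres q p u →ₗ[R] Pres q p u'} {A B : Matrix (Fin m) (Fin m') R} {w w' : R}
    (hA : IsMatrixOf φ A w) (hB : IsMatrixOf ψ B w') : IsMatrixOf (φ - ψ) (A - B) (w - w') where
  corner a b := by simp [mul_sub, sub_mul, hA.corner, hB.corner]
  gen a := by simp [hA.gen, hB.gen, sub_smul]
  rel b := by
    have := (kill q).sub_mem (hA.rel b) (hB.rel b)
    convert this using 1
    rw [vecMul_sub, Pi.sub_apply, sub_mul]
    abel

theorem pow (hp : p * p = p) {φ : Pres q p u →ₗ[R] Pres q p u} (hφ : φ ∘ₗ φ = φ)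
    {A : Matrix (Fin m) (Fin m) R} {w : R} (hA : IsMatrixOf φ A w) (t : ℕ) :
    IsMatrixOf φ (A ^ (t + 1)) (w ^ (t + 1)) := by
  induction t with
  | zero => simpa using hA
  | succ t ih =>
    have := ih.comp hp hA
    rwa [hφ, ← pow_succ, ← pow_succ] at this

end IsMatrixOf

/-- Extensions of `Pres q p u` by `X` split if the images of the relations can be corrected. -/
theorem Pres.exists_section {q p k : R} {u : Fin m → R} (hqq : q * q = q) (hp : p * p = p)
    (hup : ∀ a, u a * p = u a) (hku : ∀ a, k * u a = u a)
    {X E : Type} [AddCommGroup X] [Module R X] [AddCommGroup E] [Module R E]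
    (hqX : ∀ x : X, q • x = 0)
    (hX : ∀ z : X, k • z = z → ∃ x : Fin m → X, (∀ a, p • x a = x a) ∧ ∑ a, u a • x a = z)
    (f : X →ₗ[R] E) (g : E →ₗ[R] Pres q p u) (hf : Function.Injective f)
    (hg : Function.Surjective g) (hfg : LinearMap.range f = LinearMap.ker g) :
    ∃ s : Pres q p u →ₗ[R] E, g ∘ₗ s = LinearMap.id := by
  have hgf : ∀ x, g (f x) = 0 := fun x => by
    rw [← LinearMap.mem_ker, ← hfg]; exact LinearMap.mem_range_self f x
  have hker : ∀ y, g y = 0 → ∃ x, f x = y := fun y hy => by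
    rwa [← LinearMap.mem_ker, ← hfg] at hy
  have hqE : ∀ y : E, q • y = 0 := by
    intro y
    obtain ⟨x, hx⟩ := hker (q • y) (by rw [map_smul, Pres.smul_eq_zero])
    rw [← hqq, mul_smul, ← hx, ← map_smul, hqX, map_zero]
  choose y hy using fun a => hg (gen q p u a)
  obtain ⟨z, hz⟩ := hker (∑ a, u a • y a) (by simp only [map_sum, map_smul, hy, sum_gen hup])
  obtain ⟨x, hpx, hx⟩ := hX z (by
    apply hf
    rw [map_smul, hz, Finset.smul_sum]
    simp only [smul_smul, hku])
  obtain ⟨s, hs⟩ := exists_lift (u := u) hqE (fun a => p • y a - f (x a))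
    (fun a => by rw [smul_sub, smul_smul, hp, ← map_smul, hpx])
    (by
      simp only [smul_sub, smul_smul, hup, Finset.sum_sub_distrib]
      rw [← hz, ← hx]
      simp)
  refine ⟨s, hom_ext fun a => ?_⟩
  rw [LinearMap.comp_apply, hs, map_sub, hgf, sub_zero, map_smul, hy, smul_gen hp,
    LinearMap.id_apply]

theorem IsMinApprox.exists_sum_eq {q k p : R} (hp : p * p = p) (hu : IsMinApprox q k p u) {X : Type}
    [AddCommGroup X] [Module R X] (hqX : ∀ x : X, q • x = 0)
    (hX : Submodule.span R {x : X | p • x = x} = ⊤) (z : X) (hz : k • z = z) :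
    ∃ x : Fin m → X, (∀ a, p • x a = x a) ∧ ∑ a, u a • x a = z := by
  have key : ∀ z : X, ∀ r : R, ∃ x : Fin m → X, (∀ a, p • x a = x a) ∧
      ∑ a, u a • x a = k • r • z := by
    intro z
    have hz : z ∈ Submodule.span R {x : X | p • x = x} := hX ▸ Submodule.mem_top
    induction hz using Submodule.span_induction with
    | mem z hz =>
      intro r
      obtain ⟨s, hs, hrs⟩ := hu.gens r
      refine ⟨fun a => s a • z, fun a => ?_, ?_⟩
      · have hps : p * s a = s a := by rw [← hs a]; simp only [← mul_assoc, hp]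
        rw [smul_smul, hps]
      · have h1 := smul_eq_zero_of_mem_kill hqX hrs z
        rw [sub_smul, sub_eq_zero, mul_smul _ p, hz, mul_smul, Finset.sum_smul] at h1
        rw [h1]
        simp only [mul_smul]
    | zero => exact fun r => ⟨0, by simp, by simp⟩
    | add y z _ _ hy hz =>
      intro r
      obtain ⟨x, hx, hxy⟩ := hy r
      obtain ⟨x', hx', hxz⟩ := hz r
      refine ⟨x + x', fun a => by simp [hx, hx'], ?_⟩
      simp only [Pi.add_apply, smul_add, Finset.sum_add_distrib, hxy, hxz]
    | smul c z _ hz =>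
      intro r
      obtain ⟨x, hx, hxz⟩ := hz (r * c)
      exact ⟨x, hx, by rw [hxz, mul_smul r]⟩
  have := key z 1
  rwa [one_smul, hz] at this

end MatrixOf

namespace BasicIdems

variable {R ι : Type} [Ring R] [Fintype ι] {ε : ι → R} (h : BasicIdems ε)
include h

section

variable {q : R} {k l i : ι} {m m' : ℕ} {u : Fin m → R} {u' : Fin m' → R}

theorem eq_zero_of_isMatrixOf (hu : IsMinApprox q (ε k) (ε i) u)
    {φ : Pres q (ε i) u →ₗ[R] Pres q (ε i) u} (hφ : φ ∘ₗ φ = φ)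
    {A : Matrix (Fin m) (Fin m) R} {w : R} (hA : IsMatrixOf φ A w) (hw : IsNilpotent w) :
    φ = 0 := by
  obtain ⟨t, ht⟩ := hw
  have hAt := hA.pow (h.idem i) hφ t
  refine h.eq_zero_of_nilpotent_coeffs hφ hAt.gen fun a b => ?_
  refine hu.min (fun a => (A ^ (t + 1)) a b) ?_ a
  have := hAt.rel b
  rwa [pow_succ w, ht, zero_mul, zero_mul, sub_zero] at this

theorem notMem_kill_of_isMinApprox (hu : IsMinApprox q (ε k) (ε i) u) (a : Fin m) :
    u a ∉ kill q := by
  classical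
  intro ha
  obtain ⟨t, ht⟩ := hu.min (Pi.single a (ε i)) (by
    rw [Finset.sum_eq_single a]
    · rw [Pi.single_eq_same]; exact kill_mul_right ha _
    · intro b _ hb; simp [hb]
    · simp) a
  rw [Pi.single_eq_same, h.idem, h.idem] at ht
  have : ∀ t : ℕ, ε i * ε i ^ t = ε i := by
    intro t
    induction t with
    | zero => simp
    | succ t ih => rw [pow_succ, ← mul_assoc, ih, h.idem]
  exact h.ne_zero i (by rw [← this t, ht, mul_zero])

theorem approx_idempotent (hu : IsMinApprox q (ε k) (ε i) u) (hki : k ≠ i) (a₀ : Fin m)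
    {φ : Pres q (ε i) u →ₗ[R] Pres q (ε i) u} (hφ : φ ∘ₗ φ = φ) :
    φ = 0 ∨ φ = LinearMap.id := by
  have hii := h.idem i
  have hkk := h.idem k
  have hui : ∀ a, u a * ε i = u a := fun a => by rw [← hu.hom a, mul_assoc, hii]
  have hku : ∀ a, ε k * u a = u a := fun a => by rw [← hu.hom a]; simp only [← mul_assoc, hkk]
  obtain ⟨A, w, hw, hA⟩ := Pres.exists_isMatrixOf hii hu.hom hkk hkk hu.hom φ
  have hkw : ε k * w = w := by rw [← hw]; simp only [← mul_assoc, hkk]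
  have hwk : w * ε k = w := by rw [← hw, mul_assoc, hkk]
  have hAA := hA.comp hii hA
  have hdiff := hAA.sub hA
  rw [hφ, sub_self] at hdiff
  choose w' hw' using fun a => (Pres.sum_eq_zero_iff _).1
    ((hdiff.gen a).symm.trans (LinearMap.zero_apply _))
  set z := ∑ a, u a * w' a * ε k with hz
  have hd : ∀ b, (w * w - w - z) * u b ∈ kill q := by
    intro b
    have h1 : ∑ a, u a * ((A * A - A) a b * ε i - w' a * u b) ∈ kill q :=
      Submodule.sum_mem _ fun a _ => kill_mul_left _ (hw' a b)
    have h2 := (kill q).sub_mem h1 (hdiff.rel b)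
    have h3 : ∀ a, (A * A - A) a b * ε i = (A * A - A) a b := fun a => by
      rw [← hdiff.corner a b, mul_assoc, hii]
    convert h2 using 1
    simp only [h3, mul_sub, Finset.sum_sub_distrib, vecMul, dotProduct, sub_mul, hz,
      Finset.sum_mul, mul_assoc, hku]
    abel
  have hdk : ε k * (w * w - w - z) * ε k = w * w - w - z := by
    simp only [mul_sub, sub_mul, hz, Finset.mul_sum, Finset.sum_mul]
    simp only [← mul_assoc, hkw, hku]
    simp only [mul_assoc, hwk, hkk]
  obtain ⟨N, hN, n, hn, hkn⟩ := h.exists_simple k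
  have hdn : IsNilpotent (w * w - w - z) := by
    refine (h.nilpotent_or_unit k _ hdk).resolve_right ?_
    rintro ⟨b, -, -, hb⟩
    refine h.notMem_kill_of_isMinApprox hu a₀ ?_
    have := kill_mul_left b (hd a₀)
    rwa [← mul_assoc, hb, hku] at this
  have hzn : z • n = 0 := by
    rw [hz, Finset.sum_smul]
    refine Finset.sum_eq_zero fun a _ => ?_
    rw [mul_smul, hkn, ← hui, mul_assoc, mul_smul, mul_smul, h.smul_eq_zero_of_ne hki hn hkn,
      smul_zero]
  have hwn : w • w • n = w • n := by
    have := h.smul_eq_zero_of_isNilpotent hdn hdk hkn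
    rwa [sub_smul, hzn, sub_zero, sub_smul, sub_eq_zero, mul_smul] at this
  rcases h.nilpotent_or_unit k w hw with hnil | ⟨b, -, -, hb⟩
  · exact Or.inl (h.eq_zero_of_isMatrixOf hu hφ hA hnil)
  · right
    have hwn1 : w • n = n := by
      have := congrArg (b • ·) hwn
      simp only [smul_smul, ← mul_assoc, hb] at this
      rwa [hkw, hkn] at this
    have hφ' : (LinearMap.id - φ) ∘ₗ (LinearMap.id - φ) = LinearMap.id - φ := by
      simp [LinearMap.comp_sub, LinearMap.sub_comp, hφ]
    have hw1 : ε k * (ε k - w) * ε k = ε k - w := by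
      simp only [mul_sub, sub_mul, hkw, hwk, hkk]
    have hnil : IsNilpotent (ε k - w) := by
      refine (h.nilpotent_or_unit k _ hw1).resolve_right ?_
      rintro ⟨c, -, -, hc⟩
      apply hn
      rw [← hkn, ← hc, mul_smul, sub_smul, hkn, hwn1, sub_self, smul_zero]
    have := h.eq_zero_of_isMatrixOf hu hφ' ((IsMatrixOf.id hii hui hku).sub hA) hnil
    exact (sub_eq_zero.1 this).symm

end

variable {V : Set ι} {k l i : ι} {m m' : ℕ} {u : Fin m → R} {u' : Fin m' → R}

theorem approx_isEmpty_equiv (hi : i ∉ V) (hu : IsMinApprox (idemOf ε V) (ε k) (ε i) u)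
    (hu' : IsMinApprox (idemOf ε V) (ε l) (ε i) u') (hki : k ≠ i) (hkl : k ≠ l) (a₀ : Fin m) :
    IsEmpty (Pres (idemOf ε V) (ε i) u ≃ₗ[R] Pres (idemOf ε V) (ε i) u') := by
  refine ⟨fun φ => h.pres_gen_ne_zero (u := u) hi (Or.inr ⟨k, hki, fun a => ?_⟩) a₀ ?_⟩
  · rw [← hu.hom a]; simp only [← mul_assoc, h.idem]
  obtain ⟨A, w, hw, hA⟩ := Pres.exists_isMatrixOf (h.idem i) hu.hom (h.idem k) (h.idem l) hu'.hom
    φ.toLinearMap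
  obtain ⟨B, w', hw', hB⟩ := Pres.exists_isMatrixOf (h.idem i) hu'.hom (h.idem l) (h.idem k) hu.hom
    φ.symm.toLinearMap
  have hAB := hA.comp (h.idem i) hB
  have hid : φ.symm.toLinearMap ∘ₗ φ.toLinearMap = LinearMap.id := by ext; simp
  rw [hid] at hAB
  have hnil : IsNilpotent (w * w') := by
    have hkw : ε k * w * ε l * w' * ε k = w * w' := by
      rw [hw, mul_assoc, ← hw']
      simp only [mul_assoc, h.idem]
    exact hkw ▸ h.isNilpotent_through hkl w w'
  have := h.eq_zero_of_isMatrixOf hu (LinearMap.id_comp _) hAB hnil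
  exact LinearMap.congr_fun this _

theorem approx_isEmpty_equiv_proj (hi : i ∉ V) (hu : IsMinApprox (idemOf ε V) (ε k) (ε i) u) :
    IsEmpty (Pres (idemOf ε V) (ε i) u ≃ₗ[R] Pres (idemOf ε V) (ε i) (0 : Fin 1 → R)) := by
  refine ⟨fun φ => ?_⟩
  obtain ⟨A, w, -, hA⟩ := Pres.exists_isMatrixOf (k' := 0) (h.idem i) hu.hom (h.idem k)
    (mul_zero 0) (u' := (0 : Fin 1 → R)) (by simp) φ.toLinearMap
  obtain ⟨N, hN, hk, hq, n, hn, hin⟩ := h.exists_simple_notMem hi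
  obtain ⟨f, hf⟩ := Pres.exists_lift (u := (0 : Fin 1 → R)) hq (fun _ => n) (fun _ => hin)
    (by simp)
  have h0 : f ∘ₗ φ.toLinearMap = 0 := by
    refine Pres.hom_ext fun a => ?_
    rw [LinearMap.comp_apply, hA.gen, Fin.sum_univ_one, map_smul, hf, LinearMap.zero_apply]
    have hnil : IsNilpotent (ε i * A a 0 * ε i) :=
      hu.min (fun a => A a 0) (by simpa [vecMul, dotProduct] using hA.rel 0) a
    rw [hA.corner] at hnil
    exact h.smul_eq_zero_of_isNilpotent hnil (hA.corner a 0) hin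
  apply hn
  rw [← hf 0, ← φ.apply_symm_apply (Pres.gen _ _ _ _)]
  exact LinearMap.congr_fun h0 _

end BasicIdems

section Assemble

variable {R : Type} [Ring R]

theorem IsIndec.congr {M N : Mdl R} (hM : IsIndec M) (φ : M ≃ₗ[R] N) : IsIndec N := by
  obtain ⟨h1, h2⟩ := hM
  refine ⟨φ.symm.toEquiv.nontrivial, fun P P' hP => ?_⟩
  rw [← map_eq_bot_iff (Submodule.orderIsoMapComap φ).symm,
    ← map_eq_bot_iff (Submodule.orderIsoMapComap φ).symm]
  exact h2 _ _ ((Submodule.orderIsoMapComap φ).symm.isCompl hP)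

variable {α : Type} {M : α → Mdl R} {T : Mdl R}

/-- The internal summands of a module given as a finite product. -/
def summand [DecidableEq α] (Φ : T ≃ₗ[R] ∀ a, M a) (a : α) : Submodule R T :=
  LinearMap.range (Φ.symm.toLinearMap ∘ₗ LinearMap.single R (fun a => (M a : Type)) a)

section

variable [DecidableEq α] (Φ : T ≃ₗ[R] ∀ a, M a)

theorem iSupIndep_summand : iSupIndep (summand Φ) := by
  rw [iSupIndep_def]
  intro a
  have h1 : ⨆ (b) (_ : b ≠ a), summand Φ b ≤
      LinearMap.ker (LinearMap.proj a ∘ₗ Φ.toLinearMap) := by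
    refine iSup₂_le fun b hb => ?_
    rintro _ ⟨x, rfl⟩
    simp [hb.symm]
  refine Disjoint.mono_right h1 ?_
  rw [Submodule.disjoint_def]
  rintro _ ⟨x, rfl⟩ hx
  have : x = 0 := by simpa using hx
  simp [this]

theorem iSup_summand [Finite α] : iSup (summand Φ) = ⊤ := by
  have := Fintype.ofFinite α
  rw [eq_top_iff]
  intro x _
  have hx : x = ∑ a, Φ.symm (Pi.single a (Φ x a)) := by
    rw [← map_sum, Finset.univ_sum_single, Φ.symm_apply_apply]
  rw [hx]
  exact Submodule.sum_mem _ fun a _ =>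
    Submodule.mem_iSup_of_mem a (LinearMap.mem_range_self _ (Φ x a))

/-- The internal summands are isomorphic to the factors. -/
noncomputable def summandEquiv (a : α) : M a ≃ₗ[R] summand Φ a :=
  LinearEquiv.ofInjective _ (Φ.symm.injective.comp
    (Pi.single_injective (M := fun a => (M a : Type)) a))

theorem isDecompOf_summand [Finite α] (hM : ∀ a, IsIndec (M a)) {n : ℕ} (g : Fin n ≃ α) :
    IsDecompOf T (fun k => summand Φ (g k)) := by
  refine ⟨(iSupIndep_summand Φ).comp g.injective, ?_, fun k =>
    (hM (g k)).congr (N := ModuleCat.of R (summand Φ (g k))) (summandEquiv Φ (g k))⟩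
  rw [← iSup_summand Φ]
  exact g.iSup_comp (g := summand Φ)

end

theorem ext1Vanish_of_pi [Finite α] (Φ : T ≃ₗ[R] ∀ a, M a) {X : Mdl R}
    (hX : ∀ a, Ext1Vanish (M a) X) :
    Ext1Vanish T X := by
  classical
  have := Fintype.ofFinite α
  intro E f g hf hg hfg
  choose ψ hψ using fun a => (hX a).exists_lift f g hf hg hfg
    (Φ.symm.toLinearMap ∘ₗ LinearMap.single R (fun a => (M a : Type)) a)
  refine ⟨∑ a, ψ a ∘ₗ LinearMap.proj a ∘ₗ Φ.toLinearMap, LinearMap.ext fun x => ?_⟩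
  have h1 : ∀ a, g (ψ a (Φ x a)) = Φ.symm (Pi.single a (Φ x a)) := fun a =>
    LinearMap.congr_fun (hψ a) _
  simp only [LinearMap.comp_apply, LinearMap.sum_apply, map_sum, LinearMap.proj_apply,
    LinearEquiv.coe_coe, h1, LinearMap.id_apply]
  rw [← map_sum, Finset.univ_sum_single, Φ.symm_apply_apply]

theorem isBSTT_of_pi {Λ ι : Type} [Ring Λ] [Fintype ι] {e : ι → Λ} {S : Set ι}
    {M : S → Mdl Λᵐᵒᵖ} {T : Mdl Λᵐᵒᵖ} (Φ : T ≃ₗ[Λᵐᵒᵖ] ∀ s, M s)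
    (hfin : ∀ s, Module.Finite Λᵐᵒᵖ (M s)) (hind : ∀ s, IsIndec (M s))
    (hiso : ∀ s t, s ≠ t → IsEmpty (M s ≃ₗ[Λᵐᵒᵖ] M t))
    (hext : ∀ X, MemFac T X → ∀ s, Ext1Vanish (M s) X) (hsupp : Supp Λ e T = S) :
    IsBSTT Λ e T := by
  classical
  have hT : Module.Finite Λᵐᵒᵖ T := Module.Finite.equiv Φ.symm
  let g : Fin S.ncard ≃ S := (Finite.equivFin S).symm
  refine ⟨⟨hT, ⟨hT, fun X hX => ext1Vanish_of_pi Φ (hext X hX)⟩, ?_⟩, S.ncard, _,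
    isDecompOf_summand Φ hind g, fun k l hkl => ⟨fun φ => ?_⟩⟩
  · rw [hsupp]
    exact ⟨_, isDecompOf_summand Φ hind g⟩
  · exact (hiso (g k) (g l) (g.injective.ne hkl)).false
      ((summandEquiv Φ (g k)).trans (φ.trans (summandEquiv Φ (g l)).symm))

end Assemble

section Opposite

variable {Λ : Type} [Ring Λ]

/-- The homomorphism of right modules `Λ → M` sending `1` to `z`. -/
def evalHom {M : Type} [AddCommGroup M] [Module Λᵐᵒᵖ M] (z : M) : Λ →ₗ[Λᵐᵒᵖ] M where
  toFun x := op x • z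
  map_add' x y := by rw [op_add, add_smul]
  map_smul' r x := by simp [MulOpposite.smul_eq_mul_unop, mul_smul]

theorem evalHom_apply {M : Type} [AddCommGroup M] [Module Λᵐᵒᵖ M] (z : M) (x : Λ) :
    evalHom z x = op x • z := rfl

theorem mem_tIdeal_iff {q x : Λ} : x ∈ tIdeal Λ q ↔ op x ∈ kill (op q) := by
  constructor
  · intro hx
    have : tIdeal Λ q ≤ (kill (op q)).comap (evalHom 1) := by
      refine Submodule.span_le.2 ?_
      rintro _ ⟨a, rfl⟩
      simpa [evalHom_apply] using mul_mem_kill (op q) (op a)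
    simpa [evalHom_apply] using this hx
  · intro hx
    have : kill (op q) ≤ (tIdeal Λ q).comap (LinearMap.toSpanSingleton Λᵐᵒᵖ Λ 1) := by
      refine Submodule.span_le.2 ?_
      rintro _ ⟨r, rfl⟩
      refine Submodule.subset_span ⟨unop r, ?_⟩
      simp [MulOpposite.smul_eq_mul_unop]
    simpa using this hx

/-- The family of idempotents of `Λᵐᵒᵖ` attached to a family of idempotents of `Λ`. -/
def opIdems {ι : Type} (e : ι → Λ) (i : ι) : Λᵐᵒᵖ := op (e i)

/-- The canonical generator of `cyclicQuot Λ x`. -/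
def cyclicGen (x : Λ) : cyclicQuot Λ x := (tIdeal Λ (1 - x)).mkQ 1

theorem exists_smul_cyclicGen {x : Λ} (y : cyclicQuot Λ x) : ∃ r : Λᵐᵒᵖ, r • cyclicGen x = y := by
  obtain ⟨z, rfl⟩ := (tIdeal Λ (1 - x)).mkQ_surjective y
  refine ⟨op z, ?_⟩
  change op z • (tIdeal Λ (1 - x)).mkQ 1 = _
  rw [← map_smul]
  simp

theorem sub_smul_cyclicQuot (x : Λ) (y : cyclicQuot Λ x) : (1 - op x) • y = 0 := by
  obtain ⟨z, rfl⟩ := (tIdeal Λ (1 - x)).mkQ_surjective y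
  change (1 - op x) • (tIdeal Λ (1 - x)).mkQ z = 0
  rw [← map_smul, Submodule.mkQ_apply, Submodule.Quotient.mk_eq_zero]
  exact Submodule.subset_span ⟨z, by simp [MulOpposite.smul_eq_mul_unop]⟩

theorem smul_cyclicGen (x : Λ) : op x • cyclicGen x = cyclicGen x := by
  have := sub_smul_cyclicQuot x (cyclicGen x)
  rw [sub_smul, one_smul, sub_eq_zero] at this
  exact this.symm

theorem exists_hom_cyclicQuot {x : Λ} {M : Type} [AddCommGroup M] [Module Λᵐᵒᵖ M]
    (hM : ∀ y : M, (1 - op x) • y = 0) (z : M) :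
    ∃ f : cyclicQuot Λ x →ₗ[Λᵐᵒᵖ] M, f (cyclicGen x) = z := by
  refine ⟨(tIdeal Λ (1 - x)).liftQ (evalHom z) ?_, ?_⟩
  · refine Submodule.span_le.2 ?_
    rintro _ ⟨a, rfl⟩
    have : op (a * (1 - x)) • z = 0 := by
      rw [op_mul, mul_smul, op_sub, op_one, hM]
    exact this
  · exact one_smul Λᵐᵒᵖ z

end Opposite

namespace BasicIdems

variable {R ι : Type} [Ring R] [Fintype ι] {ε : ι → R} (h : BasicIdems ε) {M : Type}
  [AddCommGroup M] [Module R M]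
include h

theorem one_sub_smul_eq_zero_iff (i : ι) :
    (∀ x : M, (1 - ε i) • x = 0) ↔ ∀ k ≠ i, ∀ x : M, ε k • x = 0 := by
  classical
  constructor
  · intro hi k hk x
    have : ε k * (1 - ε i) = ε k := by rw [mul_sub, mul_one, h.orth k i hk, sub_zero]
    rw [← this, mul_smul, hi, smul_zero]
  · intro hk x
    have : (1 : R) - ε i = ∑ k ∈ Finset.univ.erase i, ε k := by
      rw [← h.sum_eq_one, ← Finset.sum_erase_add _ _ (Finset.mem_univ i), add_sub_cancel_right]
    rw [this, Finset.sum_smul]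
    exact Finset.sum_eq_zero fun k hki => hk k (Finset.ne_of_mem_erase hki) x

end BasicIdems

/-- A homomorphic image of a module generated by its elements fixed by `p` lies in the
submodule generated by such elements. -/
theorem map_mem_span_of_span_eq_top {R : Type} [Ring R] {p : R} {M X : Type} [AddCommGroup M]
    [Module R M] [AddCommGroup X] [Module R X] (hM : Submodule.span R {x : M | p • x = x} = ⊤)
    (f : M →ₗ[R] X) (y : M) : f y ∈ Submodule.span R {x : X | p • x = x} := by
  have : Submodule.span R {x : M | p • x = x} ≤
      (Submodule.span R {x : X | p • x = x}).comap f := by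
    refine Submodule.span_le.2 fun x hx => Submodule.subset_span ?_
    change p • f x = f x
    rw [← map_smul, hx]
  exact this (hM ▸ Submodule.mem_top)

theorem span_pi_eq_top {R α : Type} [Ring R] [Finite α] {p : R} {M : α → Type}
    [∀ a, AddCommGroup (M a)] [∀ a, Module R (M a)]
    (hM : ∀ a, Submodule.span R {x : M a | p • x = x} = ⊤) :
    Submodule.span R {x : ∀ a, M a | p • x = x} = ⊤ := by
  classical
  have := Fintype.ofFinite α
  rw [eq_top_iff]
  intro x _
  rw [← Finset.univ_sum_single x]
  exact Submodule.sum_mem _ fun a _ => map_mem_span_of_span_eq_top (hM a) (LinearMap.single R M a) _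

theorem MemFac.span_eq_top {R : Type} [Ring R] {p : R} {T X : Mdl R} (hX : MemFac T X)
    (hT : Submodule.span R {x : T | p • x = x} = ⊤) :
    Submodule.span R {x : X | p • x = x} = ⊤ := by
  obtain ⟨n, f, hf⟩ := hX
  rw [eq_top_iff]
  intro x _
  obtain ⟨y, rfl⟩ := hf x
  exact map_mem_span_of_span_eq_top (span_pi_eq_top fun _ => hT) f y

theorem Pres.span_eq_top {R : Type} [Ring R] {q p : R} (hp : p * p = p) {m : ℕ} {u : Fin m → R} :
    Submodule.span R {x : Pres q p u | p • x = x} = ⊤ := by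
  rw [eq_top_iff]
  intro y _
  obtain ⟨r, rfl⟩ := exists_eq_sum y
  exact Submodule.sum_mem _ fun a _ =>
    Submodule.smul_mem _ _ (Submodule.subset_span (smul_gen hp a))

section Modules

variable {Λ ι : Type} [Ring Λ] [Fintype ι] {e : ι → Λ}

namespace BasicIdems

variable (h : BasicIdems (opIdems e))
include h

theorem smul_cyclicQuot_eq_zero {k l : ι} (hkl : l ≠ k) (y : cyclicQuot Λ (e k)) :
    opIdems e l • y = 0 :=
  (h.one_sub_smul_eq_zero_iff k).1 (sub_smul_cyclicQuot (e k)) l hkl y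

theorem cyclicGen_ne_zero (k : ι) : cyclicGen (e k) ≠ 0 := by
  obtain ⟨N, hN, n, hn, hkn⟩ := h.exists_simple k
  obtain ⟨f, hf⟩ := exists_hom_cyclicQuot (x := e k) ((h.one_sub_smul_eq_zero_iff k).2
    fun l hl => h.smul_eq_zero_of_ne hl.symm hn hkn) n
  intro h0
  rw [h0, map_zero] at hf
  exact hn hf.symm

theorem isBSTT_of_proj {V S : Set ι} (hS : ∀ s, s ∈ S ↔ s ∉ V) {T : Mdl Λᵐᵒᵖ}
    (Φ : T ≃ₗ[Λᵐᵒᵖ] ∀ s : S, Pres (idemOf (opIdems e) V) (opIdems e s) (0 : Fin 1 → Λᵐᵒᵖ)) :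
    IsBSTT Λ e T := by
  classical
  set q := idemOf (opIdems e) V with hq
  have hqq : q * q = q := h.idemOf_mul_self V
  have hqT : ∀ x : T, q • x = 0 := fun x => by
    apply Φ.injective
    rw [map_smul, map_zero]
    exact funext fun s => Pres.smul_eq_zero _
  refine isBSTT_of_pi (M := fun s : S => ModuleCat.of Λᵐᵒᵖ
    (Pres q (opIdems e s) (0 : Fin 1 → Λᵐᵒᵖ))) Φ (fun s => ?_) (fun s => ?_) (fun s t hst => ?_)
    (fun X hX s => ?_) ?_
  · exact inferInstanceAs (Module.Finite Λᵐᵒᵖ (Pres q (opIdems e s) (0 : Fin 1 → Λᵐᵒᵖ)))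
  · have : Nontrivial (Pres q (opIdems e s) (0 : Fin 1 → Λᵐᵒᵖ)) :=
      ⟨_, _, h.pres_gen_ne_zero ((hS s).1 s.2) (Or.inl rfl) 0⟩
    exact isIndec_of_idempotents fun φ hφ => h.proj_idempotent hφ
  · exact h.proj_isEmpty_equiv ((hS s).1 s.2) fun hst' => hst (Subtype.ext hst')
  · intro E f g hf hg hfg
    refine Pres.exists_section (k := 0) hqq (h.idem s) (fun _ => zero_mul _) (fun _ => zero_mul _)
      (hX.smul_eq_zero hqT) (fun z hz => ⟨0, by simp, ?_⟩) f g hf hg hfg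
    rw [← hz]
    simp
  · ext j
    rw [hS]
    constructor
    · rintro ⟨x, hx⟩ hj
      exact hx ((h.idemOf_smul_eq_zero_iff V).1 hqT j hj x)
    · intro hj
      refine ⟨Φ.symm (Pi.single ⟨j, (hS j).2 hj⟩ (Pres.gen q (opIdems e j) 0 0)), ?_⟩
      change opIdems e j • _ ≠ _
      intro h0
      have h1 := congrFun (congrArg Φ h0) ⟨j, (hS j).2 hj⟩
      rw [map_smul, Φ.apply_symm_apply, map_zero, Pi.smul_apply, Pi.single_eq_same,
        Pres.smul_gen (h.idem j)] at h1
      exact h.pres_gen_ne_zero hj (Or.inl rfl) 0 h1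

theorem isBSTT_cyclicQuot (k : ι) : IsBSTT Λ e (cyclicQuot Λ (e k)) := by
  set q := idemOf (opIdems e) ({k}ᶜ : Set ι) with hq
  have hP : ∀ y : Pres q (opIdems e k) (0 : Fin 1 → Λᵐᵒᵖ), (1 - opIdems e k) • y = 0 :=
    (h.one_sub_smul_eq_zero_iff k).2 ((h.idemOf_smul_eq_zero_iff _).1 Pres.smul_eq_zero)
  have hX : ∀ y : cyclicQuot Λ (e k), q • y = 0 :=
    (h.idemOf_smul_eq_zero_iff _).2 fun l hl y => h.smul_cyclicQuot_eq_zero hl y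
  obtain ⟨f, hf⟩ := exists_hom_cyclicQuot (x := e k) hP (Pres.gen q _ 0 0)
  obtain ⟨g, hg⟩ := Pres.exists_lift (p := opIdems e k) (u := (0 : Fin 1 → Λᵐᵒᵖ)) hX
    (fun _ => cyclicGen (e k)) (fun _ => smul_cyclicGen (e k)) (by simp)
  let φ : cyclicQuot Λ (e k) ≃ₗ[Λᵐᵒᵖ] Pres q (opIdems e k) (0 : Fin 1 → Λᵐᵒᵖ) :=
    LinearEquiv.ofLinearMap f g
      (Pres.hom_ext fun a => by simp [Subsingleton.elim a 0, hg, hf])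
      (LinearMap.ext fun y => by
        obtain ⟨r, rfl⟩ := exists_smul_cyclicGen y
        simp [hg, hf])
  let ψ : (∀ s : ({k} : Set ι), Pres q (opIdems e s) (0 : Fin 1 → Λᵐᵒᵖ)) ≃ₗ[Λᵐᵒᵖ]
      Pres q (opIdems e k) (0 : Fin 1 → Λᵐᵒᵖ) :=
    LinearEquiv.piUnique Λᵐᵒᵖ
      (fun s : ({k} : Set ι) => Pres q (opIdems e s) (0 : Fin 1 → Λᵐᵒᵖ))
  exact h.isBSTT_of_proj (V := {k}ᶜ) (S := {k}) (by simp) (φ.trans ψ.symm)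

theorem exists_isBSTT_proj (V : Set ι) : ∃ B, IsBSTT Λ e B ∧
    (∀ x : B, idemOf (opIdems e) V • x = 0) ∧ ∀ k ∉ V, FacLE (cyclicQuot Λ (e k)) B := by
  classical
  set q := idemOf (opIdems e) V with hq
  refine ⟨ModuleCat.of Λᵐᵒᵖ (∀ s : (Vᶜ : Set ι), Pres q (opIdems e s) (0 : Fin 1 → Λᵐᵒᵖ)),
    h.isBSTT_of_proj (S := Vᶜ) (fun s => Iff.rfl) (LinearEquiv.refl _ _),
    fun x => funext fun s => Pres.smul_eq_zero _, fun k hk => ?_⟩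
  rw [facLE_iff]
  have hX : ∀ y : cyclicQuot Λ (e k), q • y = 0 :=
    (h.idemOf_smul_eq_zero_iff _).2 fun l hl y =>
      h.smul_cyclicQuot_eq_zero (ne_of_mem_of_not_mem hl hk) y
  obtain ⟨g, hg⟩ := Pres.exists_lift (p := opIdems e k) (u := (0 : Fin 1 → Λᵐᵒᵖ)) hX
    (fun _ => cyclicGen (e k)) (fun _ => smul_cyclicGen (e k)) (by simp)
  refine memFac_of_surjective (g ∘ₗ LinearMap.proj (⟨k, hk⟩ : (Vᶜ : Set ι))) fun y => ?_
  obtain ⟨r, rfl⟩ := exists_smul_cyclicGen y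
  refine ⟨fun s => r • Pres.gen q (opIdems e s) 0 0, ?_⟩
  simp [hg]

end BasicIdems

end Modules

/-- If `M` is generated by its elements fixed by `p` and `p' R p` acts by zero on `M`, then `p'`
acts by zero on `M`. -/
theorem smul_eq_zero_of_span_eq_top {R M : Type} [Ring R] [AddCommGroup M] [Module R M]
    {q p p' : R} (hq : ∀ x : M, q • x = 0)
    (hspan : Submodule.span R {x : M | p • x = x} = ⊤)
    (hp : ∀ x, p' * x * p ∈ kill q) (t : M) : p' • t = 0 := by
  have key : ∀ t : M, ∀ r : R, (p' * r) • t = 0 := by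
    intro t
    have htop : t ∈ Submodule.span R {x : M | p • x = x} := hspan ▸ Submodule.mem_top
    induction htop using Submodule.span_induction with
    | mem x hx =>
      intro r
      rw [← (hx : p • x = x), ← mul_smul]
      exact smul_eq_zero_of_mem_kill hq (hp r) x
    | zero => simp
    | add x y _ _ hx hy => intro r; rw [smul_add, hx, hy, add_zero]
    | smul a x _ hx => intro r; rw [← mul_smul, mul_assoc]; exact hx _
  simpa using key t 1

section Bongartz

variable {Λ ι : Type} [Ring Λ] [Fintype ι] {e : ι → Λ}

namespace BasicIdems

/-- The relations of the indecomposable summands of the co-Bongartz type module: either the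
projective at `i`, or a minimal left approximation starting at `k ≠ i`. -/
def IsSummandRel {R : Type} [Ring R] (q : R) (ε : ι → R) (i s : ι) {m : ℕ} (u : Fin m → R) :
    Prop :=
  (s = i ∧ m = 1 ∧ u = 0) ∨ (s ≠ i ∧ IsMinApprox q (ε s) (ε i) u)

section

variable {R : Type} [Ring R] {ε : ι → R} {V : Set ι} {i s t : ι} {m m' : ℕ} {u : Fin m → R}
  {u' : Fin m' → R} (h : BasicIdems ε)
include h

theorem isMinApprox_mul (hu : IsMinApprox (idemOf ε V) (ε s) (ε i) u) (a : Fin m) :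
    ε s * u a = u a := by
  rw [← hu.hom a]; simp only [← mul_assoc, h.idem]

theorem isIndec_summandRel (hi : i ∉ V) (hu : IsSummandRel (idemOf ε V) ε i s u) (a : Fin m) :
    IsIndec (ModuleCat.of R (Pres (idemOf ε V) (ε i) u)) := by
  rcases hu with ⟨rfl, rfl, rfl⟩ | ⟨hsi, hu⟩
  · have : Nontrivial (Pres (idemOf ε V) (ε s) (0 : Fin 1 → R)) :=
      ⟨_, _, h.pres_gen_ne_zero hi (Or.inl rfl) 0⟩
    exact isIndec_of_idempotents fun φ hφ => h.proj_idempotent hφ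
  · have : Nontrivial (Pres (idemOf ε V) (ε i) u) :=
      ⟨_, _, h.pres_gen_ne_zero hi (Or.inr ⟨s, hsi, h.isMinApprox_mul hu⟩) a⟩
    exact isIndec_of_idempotents fun φ hφ => h.approx_idempotent hu hsi a hφ

theorem isEmpty_equiv_summandRel (hi : i ∉ V) (hu : IsSummandRel (idemOf ε V) ε i s u)
    (hu' : IsSummandRel (idemOf ε V) ε i t u') (hst : s ≠ t) (a : Fin m) :
    IsEmpty (Pres (idemOf ε V) (ε i) u ≃ₗ[R] Pres (idemOf ε V) (ε i) u') := by
  rcases hu with ⟨rfl, rfl, rfl⟩ | ⟨hsi, hu⟩ <;> rcases hu' with ⟨rfl, rfl, rfl⟩ | ⟨hti, hu'⟩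
  · exact absurd rfl hst
  · exact ⟨fun φ => (h.approx_isEmpty_equiv_proj hi hu').false φ.symm⟩
  · exact h.approx_isEmpty_equiv_proj hi hu
  · exact h.approx_isEmpty_equiv hi hu hu' hsi hst a

theorem ext1Vanish_summandRel (hu : IsSummandRel (idemOf ε V) ε i s u) {X : Mdl R}
    (hqX : ∀ x : X, idemOf ε V • x = 0) (hX : Submodule.span R {x : X | ε i • x = x} = ⊤) :
    Ext1Vanish (ModuleCat.of R (Pres (idemOf ε V) (ε i) u)) X := by
  intro E f g hf hg hfg
  rcases hu with ⟨rfl, rfl, rfl⟩ | ⟨hsi, hu⟩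
  · refine Pres.exists_section (k := 0) (h.idemOf_mul_self V) (h.idem s) (fun _ => zero_mul _)
      (fun _ => zero_mul _) hqX (fun z hz => ⟨0, by simp, ?_⟩) f g hf hg hfg
    rw [← hz]
    simp
  · exact Pres.exists_section (h.idemOf_mul_self V) (h.idem i)
      (fun a => by rw [← hu.hom a, mul_assoc, h.idem]) (h.isMinApprox_mul hu) hqX
      (fun z hz => hu.exists_sum_eq (h.idem i) hqX hX z hz) f g hf hg hfg

theorem exists_summandRel (K : Type) [Field K] [Algebra K R] [FiniteDimensional K R]
    (hs : ∃ x, ε s * x * ε i ∉ kill (idemOf ε V)) :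
    ∃ (m : ℕ) (u : Fin m → R), IsSummandRel (idemOf ε V) ε i s u ∧ Nonempty (Fin m) := by
  by_cases hsi : s = i
  · exact ⟨1, 0, Or.inl ⟨hsi, rfl, rfl⟩, ⟨0⟩⟩
  · obtain ⟨m, u, hu⟩ := h.exists_isMinApprox K (idemOf ε V) s i
    refine ⟨m, u, Or.inr ⟨hsi, hu⟩, ?_⟩
    by_contra hm
    rw [not_nonempty_iff] at hm
    obtain ⟨x, hx⟩ := hs
    obtain ⟨r, -, hr⟩ := hu.gens x
    rw [Finset.univ_eq_empty, Finset.sum_empty, sub_zero] at hr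
    exact hx hr

theorem notMem_kill (hi : i ∉ V) : ε i ∉ kill (idemOf ε V) := by
  intro hk
  obtain ⟨N, hN, -, hq, n, hn, hin⟩ := h.exists_simple_notMem hi
  exact hn (hin ▸ smul_eq_zero_of_mem_kill hq hk n)

end

variable (h : BasicIdems (opIdems e))
include h

theorem exists_isBSTT_generated (K : Type) [Field K] [Algebra K Λ] [FiniteDimensional K Λ]
    {V : Set ι} {i : ι} (hi : i ∉ V) : ∃ T, IsBSTT Λ e T ∧
      (∀ x : T, idemOf (opIdems e) V • x = 0) ∧
      Submodule.span Λᵐᵒᵖ {x : T | opIdems e i • x = x} = ⊤ ∧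
      ∀ j, (∃ x, opIdems e j * x * opIdems e i ∉ kill (idemOf (opIdems e) V)) →
        ∃ t : T, opIdems e j • t ≠ 0 := by
  classical
  have : FiniteDimensional K Λᵐᵒᵖ := inferInstance
  set q := idemOf (opIdems e) V with hq
  let S : Set ι := {j | ∃ x, opIdems e j * x * opIdems e i ∉ kill q}
  choose m u hu hm using fun s : S => h.exists_summandRel K s.2
  let M : S → Mdl Λᵐᵒᵖ := fun s => ModuleCat.of Λᵐᵒᵖ (Pres q (opIdems e i) (u s))
  let T : Mdl Λᵐᵒᵖ := ModuleCat.of Λᵐᵒᵖ (∀ s : S, M s)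
  have hqT : ∀ x : T, q • x = 0 := fun x => funext fun s => Pres.smul_eq_zero (x s)
  have hspan : Submodule.span Λᵐᵒᵖ {x : T | opIdems e i • x = x} = ⊤ :=
    span_pi_eq_top (M := fun s => M s) fun s => Pres.span_eq_top (h.idem i)
  have hiS : i ∈ S := ⟨1, by rw [mul_one, h.idem]; exact h.notMem_kill hi⟩
  have hsupp : ∀ j ∈ S, ∃ t : T, opIdems e j • t ≠ 0 := by
    rintro j ⟨x, hx⟩
    by_contra! hT
    have hc : ∀ y : M ⟨i, hiS⟩, opIdems e j • y = 0 := fun y => by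
      have h0 : opIdems e j • (Pi.single ⟨i, hiS⟩ y : ∀ s, M s) = 0 := hT _
      have := congrFun h0 ⟨i, hiS⟩
      rwa [Pi.smul_apply, Pi.single_eq_same] at this
    obtain ⟨a⟩ := hm ⟨i, hiS⟩
    have hua : u ⟨i, hiS⟩ = 0 := by
      rcases hu ⟨i, hiS⟩ with ⟨-, -, h0⟩ | ⟨hne, -⟩
      · exact h0
      · exact absurd rfl hne
    have h1 := hc (x • Pres.gen q (opIdems e i) (u ⟨i, hiS⟩) a)
    have h2 : ∑ b, (Pi.single a (opIdems e j * x) : Fin _ → Λᵐᵒᵖ) b •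
        Pres.gen q (opIdems e i) (u ⟨i, hiS⟩) b = 0 := by
      rw [Finset.sum_eq_single a (fun b _ hb => by simp [hb]) (by simp), Pi.single_eq_same,
        mul_smul]
      exact h1
    obtain ⟨w, hw⟩ := (Pres.sum_eq_zero_iff _).1 h2
    have := hw a
    rw [hua, Pi.single_eq_same, Pi.zero_apply, mul_zero, sub_zero] at this
    exact hx this
  refine ⟨T, ?_, hqT, hspan, hsupp⟩
  refine isBSTT_of_pi (M := M) (LinearEquiv.refl _ _) (fun s => ?_) (fun s => ?_)
    (fun s t hst => ?_) (fun X hX s => ?_) ?_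
  · exact inferInstanceAs (Module.Finite Λᵐᵒᵖ (Pres q (opIdems e i) (u s)))
  · exact h.isIndec_summandRel hi (hu s) (hm s).some
  · exact h.isEmpty_equiv_summandRel hi (hu s) (hu t) (fun hst' => hst (Subtype.ext hst'))
      (hm s).some
  · exact h.ext1Vanish_summandRel (hu s) (hX.smul_eq_zero hqT) (hX.span_eq_top hspan)
  · refine Set.Subset.antisymm ?_ fun j hj => hsupp j hj
    rintro j ⟨t, ht⟩
    by_contra hj
    have hj' : ∀ x, opIdems e j * x * opIdems e i ∈ kill q := by
      by_contra! hx
      exact hj hx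
    exact ht (smul_eq_zero_of_span_eq_top hqT hspan hj' t)

end BasicIdems

end Bongartz

section Characterization

variable {Λ ι : Type} [Ring Λ] [Fintype ι] {e : ι → Λ}

/-- The condition `e_i Λ e_j ⊄ (∑_{v ∈ V} e_v)`, phrased in terms of the poset of basic support
τ-tilting modules and its elements `X_k`. -/
def Detects (e : ι → Λ) (V : Set ι) (i j : ι) : Prop :=
  ∃ T, IsBSTT Λ e T ∧
    (∀ B, IsBSTT Λ e B → (∀ k ∉ V, FacLE (cyclicQuot Λ (e k)) B) → FacLE T B) ∧
    (∀ k ≠ i, ¬ FacLE (cyclicQuot Λ (e k)) T) ∧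
    ∃ B, IsBSTT Λ e B ∧ (∀ k ∉ V, k ≠ j → FacLE (cyclicQuot Λ (e k)) B) ∧ ¬ FacLE T B

namespace BasicIdems

variable (h : BasicIdems (opIdems e))
include h

theorem memFac_of_cyclicQuot [IsArtinianRing Λᵐᵒᵖ] {B T : Mdl Λᵐᵒᵖ} (hB : IsTauRigid B)
    [Module.Finite Λᵐᵒᵖ T] {W : Set ι} (hT : ∀ x : T, idemOf (opIdems e) W • x = 0)
    (hW : ∀ k ∉ W, FacLE (cyclicQuot Λ (e k)) B) : MemFac B T := by
  refine hB.memFac_of_simples (q := idemOf (opIdems e) W) (fun N hN hq => ?_)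
    (isFiniteLength_of_finite T) hT
  have : Nontrivial N := hN.nontrivial
  obtain ⟨x, hx⟩ := exists_ne (0 : N)
  obtain ⟨k, hk⟩ := h.exists_smul_ne_zero hx
  have hkW : k ∉ W := fun hkW => hk ((h.idemOf_smul_eq_zero_iff W).1 hq k hkW x)
  obtain ⟨f, hf⟩ := exists_hom_cyclicQuot (x := e k) ((h.one_sub_smul_eq_zero_iff k).2
    fun l hl => h.smul_eq_zero_of_ne hl.symm hk (h.smul_smul_self k x)) (opIdems e k • x)
  refine (facLE_iff.1 (hW k hkW)).map f fun y => ?_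
  obtain ⟨r, hr⟩ := exists_smul_eq_of_isSimpleModule (R := Λᵐᵒᵖ) hk y
  exact ⟨r • cyclicGen (e k), by rw [map_smul, hf, hr]⟩

theorem span_eq_top_of_not_facLE [IsArtinianRing Λᵐᵒᵖ] {T : Mdl Λᵐᵒᵖ} (hT : IsTauRigid T) {i : ι}
    (hi : ∀ k ≠ i, ¬ FacLE (cyclicQuot Λ (e k)) T) :
    Submodule.span Λᵐᵒᵖ {x : T | opIdems e i • x = x} = ⊤ := by
  have := hT.1
  set S := Submodule.span Λᵐᵒᵖ {x : T | opIdems e i • x = x} with hS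
  by_contra hne
  have : Nontrivial (T ⧸ S) := Submodule.Quotient.nontrivial_iff.2 hne
  obtain ⟨N, hN⟩ := exists_isSimpleModule_quotient Λᵐᵒᵖ (T ⧸ S)
  have hQ : MemFac T (ModuleCat.of Λᵐᵒᵖ ((T ⧸ S) ⧸ N)) :=
    memFac_of_surjective (N.mkQ ∘ₗ S.mkQ) (N.mkQ_surjective.comp S.mkQ_surjective)
  have hiQ : ∀ y : (T ⧸ S) ⧸ N, opIdems e i • y = 0 := fun y => by
    obtain ⟨y, rfl⟩ := N.mkQ_surjective y
    obtain ⟨t, rfl⟩ := S.mkQ_surjective y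
    have h0 : S.mkQ (opIdems e i • t) = 0 := by
      rw [Submodule.mkQ_apply, Submodule.Quotient.mk_eq_zero]
      exact Submodule.subset_span (h.smul_smul_self i t)
    rw [← map_smul, ← map_smul, h0, map_zero]
  have : Nontrivial ((T ⧸ S) ⧸ N) := hN.nontrivial
  obtain ⟨y, hy⟩ := exists_ne (0 : (T ⧸ S) ⧸ N)
  obtain ⟨k, hk⟩ := h.exists_smul_ne_zero hy
  have hki : k ≠ i := by rintro rfl; exact hk (hiQ y)
  refine hi k hki (facLE_iff.2 ?_)
  have : Module.Finite Λᵐᵒᵖ (cyclicQuot Λ (e k)) := (h.isBSTT_cyclicQuot k).1.1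
  refine hT.memFac_of_simples (q := 1 - opIdems e k) (fun L hL hq => ?_)
    (@isFiniteLength_of_finite Λᵐᵒᵖ _ _ (cyclicQuot Λ (e k)) _ _ this) (sub_smul_cyclicQuot (e k))
  have : Nontrivial L := hL.nontrivial
  obtain ⟨n, hn⟩ := exists_ne (0 : L)
  have hkn : opIdems e k • n = n := by
    have := hq n
    rw [sub_smul, one_smul, sub_eq_zero] at this
    exact this.symm
  obtain ⟨f, hf⟩ := h.exists_surjective_of_isSimpleModule hk (h.smul_smul_self k y) hn hkn
  exact hQ.map f hf

theorem detects_iff (K : Type) [Field K] [Algebra K Λ] [FiniteDimensional K Λ] {V : Set ι}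
    {i j : ι} (hi : i ∉ V) : Detects e V i j ↔
      ∃ x, opIdems e j * x * opIdems e i ∉ kill (idemOf (opIdems e) V) := by
  have : FiniteDimensional K Λᵐᵒᵖ := inferInstance
  have : IsArtinianRing Λᵐᵒᵖ := IsArtinianRing.of_finite K Λᵐᵒᵖ
  constructor
  · rintro ⟨T, hT, hTV, hTi, B, hB, hBV, hTB⟩
    by_contra! hj
    have := hT.1.1
    obtain ⟨P, hP, hqP, hPV⟩ := h.exists_isBSTT_proj V
    have hqT := (facLE_iff.1 (hTV P hP hPV)).smul_eq_zero hqP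
    have hjT := smul_eq_zero_of_span_eq_top hqT
      (h.span_eq_top_of_not_facLE hT.1.2.1 hTi) hj
    refine hTB (facLE_iff.2 (h.memFac_of_cyclicQuot hB.1.2.1 (W := insert j V) ?_ fun k hk => ?_))
    · rw [h.idemOf_smul_eq_zero_iff]
      rintro v (rfl | hv)
      · exact hjT
      · exact (h.idemOf_smul_eq_zero_iff V).1 hqT v hv
    · rw [Set.mem_insert_iff, not_or] at hk
      exact hBV k hk.2 hk.1
  · intro hj
    obtain ⟨T, hT, hqT, hspan, hsupp⟩ := h.exists_isBSTT_generated K hi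
    obtain ⟨t, ht⟩ := hsupp j hj
    have := hT.1.1
    obtain ⟨B, hB, hqB, hBV⟩ := h.exists_isBSTT_proj (insert j V)
    refine ⟨T, hT, fun B' hB' hBV' => facLE_iff.2 (h.memFac_of_cyclicQuot hB'.1.2.1 hqT hBV'),
      fun k hki hk => ?_, B, hB, fun k hkV hkj => hBV k ?_, fun hTB => ?_⟩
    · have htop := (facLE_iff.1 hk).span_eq_top hspan
      have hbot : Submodule.span Λᵐᵒᵖ {x : cyclicQuot Λ (e k) | opIdems e i • x = x} = ⊥ := by
        rw [Submodule.span_eq_bot]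
        intro x hx
        rw [← (hx : opIdems e i • x = x)]
        exact h.smul_cyclicQuot_eq_zero hki.symm x
      refine h.cyclicGen_ne_zero k ((Submodule.mem_bot Λᵐᵒᵖ).1 ?_)
      rw [← hbot, htop]
      exact Submodule.mem_top
    · rw [Set.mem_insert_iff, not_or]
      exact ⟨hkj, hkV⟩
    · exact ht ((h.idemOf_smul_eq_zero_iff _).1 ((facLE_iff.1 hTB).smul_eq_zero hqB) j
        (Set.mem_insert j V) t)

end BasicIdems

end Characterization

section Transfer

variable {Λ Γ ι ι' : Type} [Ring Λ] [Ring Γ] [Fintype ι] {e : ι → Λ} {f : ι' → Γ}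

/-- The inverse of an isomorphism of posets. -/
def PosetIsoP.symm {A B : Type} [Ring A] [Ring B] {PA : Mdl A → Prop} {PB : Mdl B → Prop}
    (ρ : PosetIsoP PA PB) : PosetIsoP PB PA where
  toFun := ρ.invFun
  invFun := ρ.toFun
  maps := ρ.maps'
  maps' := ρ.maps
  le_iff := ρ.le_iff'
  le_iff' := ρ.le_iff
  left_inv := ρ.right_inv
  right_inv := ρ.left_inv

theorem Detects.map (h : BasicIdems (opIdems e)) (ρ : PosetIsoP (IsBSTT Λ e) (IsBSTT Γ f))
    (σ : ι ≃ ι') (hσ : ∀ i, PE (ρ.toFun (cyclicQuot Λ (e i))) (cyclicQuot Γ (f (σ i))))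
    {V : Set ι} {i j : ι} (hd : Detects e V i j) :
    Detects f (σ.symm ⁻¹' V) (σ i) (σ j) := by
  have hX : ∀ k B, IsBSTT Λ e B →
      (FacLE (cyclicQuot Λ (e k)) B ↔ FacLE (cyclicQuot Γ (f (σ k))) (ρ.toFun B)) := by
    intro k B hB
    rw [ρ.le_iff _ _ (h.isBSTT_cyclicQuot k) hB]
    exact ⟨(hσ k).2.trans, (hσ k).1.trans⟩
  obtain ⟨T, hT, hTV, hTi, B, hB, hBV, hTB⟩ := hd
  refine ⟨ρ.toFun T, ρ.maps T hT, fun C hC hCV => ?_, fun k' hk' hT' => ?_, ρ.toFun B,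
    ρ.maps B hB, fun k' hk' hkj' => ?_, fun hTB' => hTB ((ρ.le_iff T B hT hB).2 hTB')⟩
  · have hC' := ρ.maps' C hC
    refine ((ρ.le_iff T _ hT hC').1 (hTV _ hC' fun k hk => ?_)).trans (ρ.right_inv C hC).1
    rw [hX k _ hC']
    exact (hCV (σ k) (by simpa using hk)).trans (ρ.right_inv C hC).2
  · obtain ⟨k, rfl⟩ := σ.surjective k'
    exact hTi k (fun hki => hk' (congrArg σ hki)) ((hX k T hT).2 hT')
  · obtain ⟨k, rfl⟩ := σ.surjective k'
    exact (hX k B hB).1 (hBV k (by simpa using hk') fun hkj => hkj' (congrArg σ hkj))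

theorem detects_iff_of_posetIso [Fintype ι'] (h : BasicIdems (opIdems e))
    (h' : BasicIdems (opIdems f))
    (ρ : PosetIsoP (IsBSTT Λ e) (IsBSTT Γ f)) (σ : ι ≃ ι')
    (hσ : ∀ i, PE (ρ.toFun (cyclicQuot Λ (e i))) (cyclicQuot Γ (f (σ i)))) {V : Set ι}
    {i j : ι} : Detects e V i j ↔ Detects f (σ.symm ⁻¹' V) (σ i) (σ j) := by
  refine ⟨Detects.map h ρ σ hσ, fun hd => ?_⟩
  have := hd.map h' ρ.symm σ.symm fun k' => ?_
  · simpa [Set.preimage_preimage] using this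
  · obtain ⟨k, rfl⟩ := σ.surjective k'
    rw [σ.symm_apply_apply]
    have hk := h.isBSTT_cyclicQuot k
    have hk' := h'.isBSTT_cyclicQuot (σ k)
    have hinv := ρ.left_inv _ hk
    exact ⟨((ρ.le_iff' _ _ hk' (ρ.maps _ hk)).1 (hσ k).2).trans hinv.1,
      hinv.2.trans ((ρ.le_iff' _ _ (ρ.maps _ hk) hk').1 (hσ k).1)⟩

theorem exists_notMem_tIdeal_iff {q : Λ} {V : Set ι} (hq : op q = idemOf (opIdems e) V) {i j : ι} :
    (∃ x, e i * x * e j ∉ tIdeal Λ q) ↔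
      ∃ x, opIdems e j * x * opIdems e i ∉ kill (idemOf (opIdems e) V) := by
  rw [op_surjective.exists]
  refine exists_congr fun x => ?_
  rw [mem_tIdeal_iff, hq, mul_assoc]
  rfl

end Transfer

end TauTilting

open TauTilting in
open scoped Classical in
/-- Let `ρ : sτtilt Λ → sτtilt Γ` be a poset isomorphism with
induced quiver isomorphism `σ : Q* → (Q')*`.  Then for every `V ⊆ Q₀` and every
`i ∉ V`, `supp(e_{σ(i)}(Γ/(Σ_{v∈V} e_{σ(v)}))) = σ(supp(e_i(Λ/(Σ_{v∈V} e_v))))`.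
(For the right module `e_i(Λ/(q))`, `j` lies in its support iff
`e_i Λ e_j ⊄ (q)`.) -/
theorem statement14
    (K : Type) [Field K]
    (Λ : Type) [Ring Λ] [Algebra K Λ] [FiniteDimensional K Λ]
    (ι : Type) [Fintype ι] [DecidableEq ι] (e : ι → Λ)
    (Arr : ι → ι → Type) [∀ i j, Fintype (Arr i j)] (arr : ∀ i j, Arr i j → Λ)
    (hpres : IsGabrielPres Λ K e Arr arr)
    (Γ : Type) [Ring Γ] [Algebra K Γ] [FiniteDimensional K Γ]
    (ι' : Type) [Fintype ι'] [DecidableEq ι'] (f : ι' → Γ)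
    (Arr' : ι' → ι' → Type) [∀ i j, Fintype (Arr' i j)] (arr' : ∀ i j, Arr' i j → Γ)
    (hpres' : IsGabrielPres Γ K f Arr' arr')
    (ρ : PosetIsoP (IsBSTT Λ e) (IsBSTT Γ f))
    (σ : ι → ι')
    (hσ : ∀ i, PE (ρ.toFun (cyclicQuot Λ (e i))) (cyclicQuot Γ (f (σ i))))
    -- σ extends to the quiver isomorphism Q* ≅ (Q')*
    (hσbij : Function.Bijective σ)
    (hσarr : ∀ i j : ι, i ≠ j → (Nonempty (Arr i j) ↔ Nonempty (Arr' (σ i) (σ j)))) :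
    ∀ (V : Set ι) (i : ι), i ∉ V → ∀ (qV : Λ) (qV' : Γ),
      qV = (∑ v : ι, if v ∈ V then e v else 0) →
      qV' = (∑ v : ι, if v ∈ V then f (σ v) else 0) →
      ∀ j : ι,
        ((∃ x, e i * x * e j ∉ tIdeal Λ qV) ↔
         (∃ y, f (σ i) * y * f (σ j) ∉ tIdeal Γ qV')) := by
  intro V i hi qV qV' hV hV' j
  let s : ι ≃ ι' := Equiv.ofBijective σ hσbij
  have h := basicIdems_op K hpres.1 hpres.2.1
  have h' := basicIdems_op K hpres'.1 hpres'.2.1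
  have hq : op qV = idemOf (opIdems e) V := by
    rw [hV, idemOf, Finset.op_sum]
    refine Finset.sum_congr rfl fun v _ => ?_
    split_ifs <;> rfl
  have hq' : op qV' = idemOf (opIdems f) (s.symm ⁻¹' V) := by
    rw [hV', idemOf, Finset.op_sum, ← s.sum_comp]
    refine Finset.sum_congr rfl fun v _ => ?_
    simp only [Set.mem_preimage, s.symm_apply_apply]
    split_ifs <;> rfl
  rw [exists_notMem_tIdeal_iff hq, exists_notMem_tIdeal_iff hq',
    ← h.detects_iff K hi, detects_iff_of_posetIso h h' ρ s hσ, h'.detects_iff K]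
  · rfl
  · simpa using hi
end

section
/- Suppose there is an arrow α from i to j in Q° (so i ≠ j). Then αΛe_j = e_iΛe_j = e_iΛα if and only if the module P_i ⊕ (e_iΛ / e_iΛe_jΛ) is τ-rigid. -/
/-!
Common framework for formalizing statements from
"From support τ-tilting posets to algebras" (R. Kase).

Modules over the basic finite dimensional algebra `Λ` are taken to be *right*
modules, encoded as (left) modules over the opposite ring `Λᵐᵒᵖ`.
τ-rigidity is encoded through the Auslander–Smalø criterion:
`Hom(M, τM) = 0` iff `Ext¹(M, Fac M) = 0`, and the vanishing of `Ext¹(M, X)`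
is encoded by the splitting of all short exact sequences `0 → X → E → M → 0`.
-/

open MulOpposite

namespace TauTilting

section PrimitiveIdempotents

variable {Λ : Type} [Ring Λ]

/-- In the corner ring of a primitive idempotent every element is nilpotent or invertible. -/
lemma IsPrimIdem.nilpotent_or_inv (K : Type) [Field K] [Algebra K Λ] [FiniteDimensional K Λ]
    {e l : Λ} (he : IsPrimIdem Λ e) (hel : e * l = l)
    (hle : l * e = l) : (∃ n : ℕ, l ^ n = 0) ∨ ∃ m, m * l = e ∧ l * m = e := by
  open Polynomial in
  have hint : IsIntegral K l := Algebra.IsIntegral.isIntegral l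
  obtain ⟨q, hq, hdvd⟩ :=
    (minpoly K l).exists_eq_pow_rootMultiplicity_mul_and_not_dvd (minpoly.ne_zero hint) 0
  set n := (minpoly K l).rootMultiplicity 0
  simp only [map_zero, sub_zero] at hq hdvd
  obtain ⟨u, v, huv⟩ : IsCoprime (X ^ (n + 1) : K[X]) q :=
    IsCoprime.pow_left ((irreducible_X.coprime_iff_not_dvd).2 hdvd)
  have hz : l ^ (n + 1) * aeval l q = 0 := by
    have h := minpoly.aeval K l
    rw [hq, map_mul, map_pow, aeval_X] at h
    rw [pow_succ', mul_assoc, h, mul_zero]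
  set U := aeval l u
  set V := aeval l v
  set Z := aeval l q
  have hone : U * l ^ (n + 1) + V * Z = 1 := by
    simpa [U, V, Z] using congrArg (aeval l) huv
  have hUl : U * l = l * U := by
    simpa [U] using congrArg (aeval l) (mul_comm u X)
  have hVl : V * l = l * V := by
    simpa [V] using congrArg (aeval l) (mul_comm v X)
  have hUl' : Commute U (l ^ (n + 1)) := Commute.pow_right hUl _
  have hVl' : Commute V (l ^ (n + 1)) := Commute.pow_right hVl _
  have hlE : l ^ (n + 1) * (U * l ^ (n + 1)) = l ^ (n + 1) := by
    have h : l ^ (n + 1) * (U * l ^ (n + 1) + V * Z) = l ^ (n + 1) := by rw [hone, mul_one]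
    rwa [mul_add, ← mul_assoc _ V, ← hVl'.eq, mul_assoc V, hz, mul_zero, add_zero] at h
  have hle' : l ^ (n + 1) * e = l ^ (n + 1) := by rw [pow_succ, mul_assoc, hle]
  have hel' : e * l ^ (n + 1) = l ^ (n + 1) := by rw [pow_succ', ← mul_assoc, hel]
  set E := U * l ^ (n + 1) with hE
  have hEE : E * E = E := by
    nth_rewrite 1 [hE]; rw [mul_assoc, hlE]
  have hEe : E * e = E := by rw [hE, mul_assoc, hle']
  have heE : e * E = E := by rw [hE, hUl'.eq, ← mul_assoc, hel']
  rcases he.2.2 E (e - E) hEE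
    (by simp only [IsIdempotentElem, mul_sub, sub_mul, hEE, hEe, heE, he.1.eq]; abel)
    (by rw [mul_sub, hEe, hEE, sub_self]) (by rw [sub_mul, heE, hEE, sub_self])
    (by abel) with h | h
  · left
    exact ⟨n + 1, by rw [← hlE, h, mul_zero]⟩
  · right
    have hEe' : E = e := (sub_eq_zero.1 h).symm
    refine ⟨U * l ^ n, ?_, ?_⟩
    · rw [mul_assoc, ← pow_succ, ← hE, hEe']
    · rw [← mul_assoc, ← hUl, mul_assoc, ← pow_succ', ← hE, hEe']

/-- `eΛ` has a unique maximal submodule: an element outside the radical generates `eΛ`. -/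
lemma IsPrimIdem.exists_mul_eq (K : Type) [Field K] [Algebra K Λ] [FiniteDimensional K Λ]
    {e x : Λ} (he : IsPrimIdem Λ e) (hex : e * x = x)
    (hx : x ∉ Ring.jacobson Λ) : ∃ y, x * y = e := by
  by_contra! hne
  apply hx
  rw [← Ideal.jacobson_bot, Ideal.mem_jacobson_iff]
  intro y
  have hnil : IsNilpotent (y * x) := by
    rcases he.nilpotent_or_inv K (l := x * y * e) (by simp only [← mul_assoc, hex])
      (by rw [mul_assoc, he.1.eq]) with ⟨n, hn⟩ | ⟨m, -, hm⟩
    · have hpow : ∀ k : ℕ, (y * x) ^ (k + 1) = y * (x * y * e) ^ k * x := by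
        intro k
        induction k with
        | zero => simp
        | succ k ih =>
          rw [pow_succ, ih, pow_succ (x * y * e)]
          simp only [mul_assoc, hex]
      exact ⟨n + 1, by rw [hpow, hn, mul_zero, zero_mul]⟩
    · exact absurd (by simpa only [mul_assoc] using hm) (hne (y * (e * m)))
  obtain ⟨z, -, hz⟩ := isUnit_iff_exists.1 hnil.isUnit_one_add
  refine ⟨z, ?_⟩
  rw [Ideal.mem_bot, ← hz]
  noncomm_ring

end PrimitiveIdempotents

section Extensions

variable {Λ : Type} [Ring Λ]

/-- If `xΛ ⊕ Λ/U` is τ-rigid, a homomorphism from `U` to a quotient of `xΛ`, given by its graph `R`,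
is left multiplication by some element of `Λ`. -/
lemma IsTauRigid.exists_mul_mem {x : Λ} {U : Submodule Λᵐᵒᵖ Λ}
    (h : IsTauRigid (dsum (projMod Λ x) (quotMod Λ U))) (R : Submodule Λᵐᵒᵖ (Λ × Λ))
    (hdom : ∀ u ∈ U, ∃ y, (u, y) ∈ R) (hdom' : ∀ p ∈ R, p.1 ∈ U) (hx : (0, 1 - x) ∈ R) :
    ∃ l, ∀ u ∈ U, (u, l * u) ∈ R := by
  let N : Submodule Λᵐᵒᵖ Λ := R.comap (LinearMap.inr Λᵐᵒᵖ Λ Λ)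
  have hN : rSpan Λ {1 - x} ≤ N := by
    rw [rSpan, Submodule.span_singleton_le_iff_mem]
    exact hx
  let P := Λ ⧸ rSpan Λ {1 - x}
  let f : (Λ ⧸ N) →ₗ[Λᵐᵒᵖ] P × ((Λ × Λ) ⧸ R) :=
    (LinearMap.inr _ _ _).comp (N.mapQ R (LinearMap.inr Λᵐᵒᵖ Λ Λ) le_rfl)
  let g₂ : ((Λ × Λ) ⧸ R) →ₗ[Λᵐᵒᵖ] Λ ⧸ U :=
    R.mapQ U (LinearMap.fst Λᵐᵒᵖ Λ Λ) hdom'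
  let g : (P × ((Λ × Λ) ⧸ R)) →ₗ[Λᵐᵒᵖ] P × (Λ ⧸ U) := LinearMap.prodMap LinearMap.id g₂
  have hfac : MemFac (dsum (projMod Λ x) (quotMod Λ U)) (ModuleCat.of Λᵐᵒᵖ (Λ ⧸ N)) := by
    let φ : (Fin 1 → P × (Λ ⧸ U)) →ₗ[Λᵐᵒᵖ] Λ ⧸ N :=
      (Submodule.factor hN).comp ((LinearMap.fst _ _ _).comp (LinearMap.proj 0))
    refine ⟨1, φ, fun y => ?_⟩
    obtain ⟨y, rfl⟩ := Submodule.mkQ_surjective _ y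
    exact ⟨fun _ => (Submodule.mkQ _ y, 0), rfl⟩
  have hf : Function.Injective f := by
    rw [← LinearMap.ker_eq_bot, LinearMap.ker_eq_bot']
    intro y hy
    obtain ⟨y, rfl⟩ := Submodule.mkQ_surjective _ y
    have hy' := (Prod.ext_iff.1 hy).2
    exact (Submodule.Quotient.mk_eq_zero N).2 ((Submodule.Quotient.mk_eq_zero R).1 hy')
  have hg : Function.Surjective g := by
    rintro ⟨p, s⟩
    obtain ⟨s, rfl⟩ := Submodule.mkQ_surjective _ s
    exact ⟨(p, Submodule.mkQ _ (s, 0)), rfl⟩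
  have hfg : LinearMap.range f = LinearMap.ker g := by
    ext ⟨p, z⟩
    obtain ⟨⟨u, y⟩, rfl⟩ := Submodule.mkQ_surjective _ z
    constructor
    · rintro ⟨w, hw⟩
      obtain ⟨w, rfl⟩ := Submodule.mkQ_surjective _ w
      rw [← hw]
      refine Prod.ext rfl ?_
      exact (Submodule.Quotient.mk_eq_zero U).2 U.zero_mem
    · intro hz
      obtain ⟨h₁, h₂⟩ := Prod.ext_iff.1 hz
      have hu : u ∈ U := (Submodule.Quotient.mk_eq_zero U).1 h₂
      obtain ⟨y₀, hy₀⟩ := hdom u hu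
      refine ⟨Submodule.mkQ _ (y - y₀), Prod.ext h₁.symm ?_⟩
      refine (Submodule.Quotient.eq R).2 ?_
      have : LinearMap.inr Λᵐᵒᵖ Λ Λ (y - y₀) - (u, y) = -(u, y₀) := by ext <;> simp
      rw [this]
      exact R.neg_mem hy₀
  obtain ⟨s, hs⟩ := h.2 _ hfac (ModuleCat.of Λᵐᵒᵖ (P × ((Λ × Λ) ⧸ R))) f g hf hg hfg
  change P × (Λ ⧸ U) →ₗ[Λᵐᵒᵖ] P × ((Λ × Λ) ⧸ R) at s
  let t : Λ →ₗ[Λᵐᵒᵖ] (Λ × Λ) ⧸ R :=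
    (LinearMap.snd _ _ _).comp (s.comp ((LinearMap.inr _ _ _).comp U.mkQ))
  obtain ⟨⟨u₀, y₀⟩, ht⟩ := Submodule.mkQ_surjective _ (t 1)
  have h1 : u₀ - 1 ∈ U := by
    have h := (Prod.ext_iff.1 (LinearMap.congr_fun hs (0, U.mkQ 1))).2
    change g₂ (t 1) = U.mkQ 1 at h
    rw [← ht] at h
    exact (Submodule.Quotient.eq U).1 h
  obtain ⟨y₁, hy₁⟩ := hdom _ h1
  refine ⟨y₀ - y₁, fun u hu => ?_⟩
  have htu : t u = 0 := by
    have : U.mkQ u = 0 := (Submodule.Quotient.mk_eq_zero U).2 hu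
    simp only [t, LinearMap.comp_apply, this, map_zero]
  have htu' : t u = R.mkQ (MulOpposite.op u • (u₀, y₀)) := by
    rw [map_smul, ht, ← map_smul]
    exact congrArg t (one_mul u).symm
  rw [htu'] at htu
  have hmem := (Submodule.Quotient.mk_eq_zero R).1 htu
  have := R.sub_mem hmem (R.smul_mem (MulOpposite.op u) hy₁)
  convert this using 1
  ext
  · simp [sub_mul]
  · simp [sub_mul]

end Extensions

section Arrow

variable {Λ : Type} [Ring Λ]

/-- Left multiplication, as an endomorphism of the right regular module. -/
def mulLeftHom (x : Λ) : Λ →ₗ[Λᵐᵒᵖ] Λ where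
  toFun y := x * y
  map_add' := mul_add x
  map_smul' b y := (mul_assoc x y b.unop).symm

/-- The Jacobson radical as a right ideal. -/
def rightJacobson (Λ : Type) [Ring Λ] : Submodule Λᵐᵒᵖ Λ where
  carrier := Ring.jacobson Λ
  add_mem' := (Ring.jacobson Λ).add_mem
  zero_mem' := (Ring.jacobson Λ).zero_mem
  smul_mem' b _ hx := (Ring.jacobson Λ).mul_mem_right b.unop hx

/-- The right ideal of those `n` with `xn ∈ y rad Λ`. -/
def radColon (x y : Λ) : Submodule Λᵐᵒᵖ Λ :=
  ((rightJacobson Λ).map (mulLeftHom y)).comap (mulLeftHom x)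

lemma mem_radColon {x y n : Λ} : n ∈ radColon x y ↔ ∃ r ∈ Ring.jacobson Λ, y * r = x * n :=
  Iff.rfl

lemma mem_span_singleton_op {x y : Λ} : y ∈ Submodule.span Λᵐᵒᵖ {x} ↔ ∃ b, x * b = y :=
  Submodule.mem_span_singleton.trans
    ⟨fun ⟨b, hb⟩ => ⟨b.unop, hb⟩, fun ⟨b, hb⟩ => ⟨MulOpposite.op b, hb⟩⟩

/-- The graph attached to `a ↦ b` on `aΛ`, with `C` sent to `0`, modulo `N`. -/
def graphOf (a b : Λ) (C N : Submodule Λᵐᵒᵖ Λ) : Submodule Λᵐᵒᵖ (Λ × Λ) :=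
  Submodule.span Λᵐᵒᵖ {(a, b)} ⊔ C.prod N

lemma mem_graphOf {a b u y : Λ} {C N : Submodule Λᵐᵒᵖ Λ} :
    (u, y) ∈ graphOf a b C N ↔ ∃ t, ∃ c ∈ C, ∃ n ∈ N, u = a * t + c ∧ y = b * t + n := by
  simp only [graphOf, Submodule.mem_sup, Submodule.mem_span_singleton]
  constructor
  · rintro ⟨_, ⟨t, rfl⟩, ⟨c, n⟩, ⟨hc, hn⟩, h⟩
    exact ⟨t.unop, c, hc, n, hn, (Prod.ext_iff.1 h).1.symm, (Prod.ext_iff.1 h).2.symm⟩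
  · rintro ⟨t, c, hc, n, hn, rfl, rfl⟩
    exact ⟨_, ⟨MulOpposite.op t, rfl⟩, (c, n), ⟨hc, hn⟩, rfl⟩

lemma exists_one_add_mul_eq_one [IsNoetherianRing Λ] {r : Λ} (hr : r ∈ Ring.jacobson Λ) :
    ∃ s, (1 + r) * s = 1 := by
  rw [← Ideal.jacobson_bot, Ideal.mem_jacobson_iff] at hr
  obtain ⟨s, hs⟩ := hr 1
  refine ⟨s, mul_eq_one_symm ?_⟩
  rw [Ideal.mem_bot, sub_eq_zero] at hs
  rw [mul_one] at hs
  rw [mul_add, mul_one, add_comm, hs]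

variable (Λ) in
lemma isNoetherian_op (K : Type) [Field K] [Algebra K Λ] [FiniteDimensional K Λ] :
    IsNoetherian Λᵐᵒᵖ Λ := by
  have : IsScalarTower K Λᵐᵒᵖ Λ := ⟨fun k b x => by simp⟩
  exact isNoetherian_of_tower K inferInstance

/-- An element of `eⱼΛ` killed from the left by some nonzero `α = αeⱼ` lies in the radical; more
generally this holds if it sends `α` into a right ideal not containing `α`. -/
lemma IsPrimIdem.mem_jacobson_of_mul_mem (K : Type) [Field K] [Algebra K Λ]
    [FiniteDimensional K Λ] {e α : Λ} (he : IsPrimIdem Λ e) (hα : α * e = α)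
    {C : Submodule Λᵐᵒᵖ Λ} (hC : α ∉ C) {t : Λ} (ht : α * t ∈ C) :
    e * t ∈ Ring.jacobson Λ := by
  by_contra h
  obtain ⟨z, hz⟩ := he.exists_mul_eq K (by rw [← mul_assoc, he.1.eq]) h
  have : α * t * z ∈ C := C.smul_mem (MulOpposite.op z) ht
  rw [← hα, mul_assoc, mul_assoc, ← mul_assoc e, hz, hα] at this
  exact hC this

/-- `(1 - eᵢ)Λ + eᵢΛeⱼΛ`. -/
abbrev traceIdeal (ei ej : Λ) : Submodule Λᵐᵒᵖ Λ :=
  Submodule.span Λᵐᵒᵖ ({1 - ei} ∪ {y : Λ | ∃ x, y = ei * x * ej})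

lemma one_sub_mem_traceIdeal (ei ej : Λ) : 1 - ei ∈ traceIdeal ei ej :=
  Submodule.subset_span (Or.inl rfl)

lemma mul_mul_mem_traceIdeal (ei ej x : Λ) : ei * x * ej ∈ traceIdeal ei ej :=
  Submodule.subset_span (Or.inr ⟨x, rfl⟩)

variable {ei ej α : Λ}

/-- If `xΛ ⊕ xΛ/xΛyΛ` is τ-rigid, then every `α ∈ xΛy` outside a right ideal `Q ⊇ xΛy rad Λ`
generates `xΛyΛ` as a right ideal. -/
lemma exists_eq_mul_of_isTauRigid (K : Type) [Field K] [Algebra K Λ]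
    [FiniteDimensional K Λ] (hi : IsPrimIdem Λ ei) (hj : IsPrimIdem Λ ej)
    (hiα : ei * α = α) (hαj : α * ej = α)
    (h : IsTauRigid (dsum (projMod Λ ei) (quotMod Λ (traceIdeal ei ej))))
    (Q : Submodule Λᵐᵒᵖ Λ) (hαQ : α ∉ Q)
    (hQ : ∀ x, ∀ r ∈ Ring.jacobson Λ, ei * x * ej * r ∈ Q) (x : Λ) :
    ∃ b, ei * x * ej = α * b := by
  have : IsNoetherianRing Λ := IsNoetherianRing.of_finite K Λ
  set U := traceIdeal ei ej with hU
  have hi0 : ei * (1 - ei) = 0 := by rw [mul_sub, mul_one, hi.1.eq, sub_self]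
  have hαU : α ∈ U := by
    have := mul_mul_mem_traceIdeal ei ej α
    rwa [hiα, hαj] at this
  have hα0 : α ≠ 0 := fun h0 => hαQ (h0 ▸ Q.zero_mem)
  obtain ⟨C, ⟨hCU, hQC, hαC⟩, hmax⟩ := set_has_maximal_iff_noetherian.2 (isNoetherian_op Λ K)
    {C : Submodule Λᵐᵒᵖ Λ | C ≤ U ∧ U ⊓ Q.comap (mulLeftHom ei) ≤ C ∧ α ∉ C}
    ⟨U ⊓ Q.comap (mulLeftHom ei), inf_le_left, le_rfl, fun hmem => hαQ (hiα ▸ hmem.2)⟩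
  have heC : 1 - ei ∈ C := hQC ⟨one_sub_mem_traceIdeal ei ej, by
    change ei * (1 - ei) ∈ Q
    rw [hi0]
    exact Q.zero_mem⟩
  have hradC : ∀ x, ∀ r ∈ Ring.jacobson Λ, ei * x * ej * r ∈ C := fun x r hr =>
    hQC ⟨U.smul_mem (MulOpposite.op r) (mul_mul_mem_traceIdeal ei ej x), by
      change ei * (ei * x * ej * r) ∈ Q
      simpa only [← mul_assoc, hi.1.eq] using hQ x r hr⟩
  have hgen : U ≤ Submodule.span Λᵐᵒᵖ {α} ⊔ C := by
    refine Submodule.span_le.2 ?_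
    rintro _ (rfl | ⟨x, rfl⟩)
    · exact Submodule.mem_sup_right heC
    by_cases hβ : ei * x * ej ∈ C
    · exact Submodule.mem_sup_right hβ
    set β := ei * x * ej with hβdef
    have hβj : β * ej = β := by rw [hβdef, mul_assoc, hj.1.eq]
    have hα : α ∈ C ⊔ Submodule.span Λᵐᵒᵖ {β} := by
      by_contra hα
      refine hmax _ ⟨sup_le hCU ?_, hQC.trans le_sup_left, hα⟩ (left_lt_sup.2 fun hle => ?_)
      · rw [Submodule.span_singleton_le_iff_mem]
        exact mul_mul_mem_traceIdeal ei ej x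
      · exact hβ (hle (Submodule.mem_span_singleton_self β))
    obtain ⟨c, hc, _, hy, hcy⟩ := Submodule.mem_sup.1 hα
    obtain ⟨y, rfl⟩ := mem_span_singleton_op.1 hy
    have hy' : ej * y ∉ Ring.jacobson Λ := fun hr => hαC <| by
      rw [← hcy, ← hβj, mul_assoc]
      exact C.add_mem hc (hradC x _ hr)
    obtain ⟨z, hz⟩ := hj.exists_mul_eq K (by rw [← mul_assoc, hj.1.eq]) hy'
    have hβz : β = α * z + -(c * z) := by
      rw [← hcy, add_mul, mul_assoc β, ← hβj, mul_assoc β, ← mul_assoc ej, hz]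
      abel
    rw [hβz]
    exact add_mem (Submodule.mem_sup_left (mem_span_singleton_op.2 ⟨z, rfl⟩))
      (Submodule.mem_sup_right (C.neg_mem (C.smul_mem (MulOpposite.op z) hc)))
  have hdec : ∀ u ∈ U, ∃ t, ∃ c ∈ C, u = α * t + c := fun u hu => by
    obtain ⟨_, ht, c, hc, rfl⟩ := Submodule.mem_sup.1 (hgen hu)
    obtain ⟨t, rfl⟩ := mem_span_singleton_op.1 ht
    exact ⟨t, c, hc, rfl⟩
  have hrad : ∀ t, α * t ∈ C → ∃ r ∈ Ring.jacobson Λ, α * t = α * r := fun t ht =>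
    ⟨ej * t, hj.mem_jacobson_of_mul_mem K hαj hαC ht, by rw [← mul_assoc, hαj]⟩
  obtain ⟨l, hl⟩ := h.exists_mul_mem (graphOf α α C (radColon ei α))
    (fun u hu => by
      obtain ⟨t, c, hc, rfl⟩ := hdec u hu
      exact ⟨α * t, mem_graphOf.2 ⟨t, c, hc, 0, zero_mem _, rfl, (add_zero _).symm⟩⟩)
    (by
      rintro ⟨u, y⟩ hp
      obtain ⟨t, c, hc, -, -, rfl, -⟩ := mem_graphOf.1 hp
      exact U.add_mem (U.smul_mem (MulOpposite.op t) hαU) (hCU hc))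
    (mem_graphOf.2 ⟨0, 0, C.zero_mem, 1 - ei,
      mem_radColon.2 ⟨0, zero_mem _, by rw [hi0, mul_zero]⟩, by simp, by simp⟩)
  set l' := ei * l * ei with hl'
  obtain ⟨r, hr, hlα⟩ : ∃ r ∈ Ring.jacobson Λ, l' * α = α * (1 + r) := by
    obtain ⟨t, c, hc, n, hn, h₁, h₂⟩ := mem_graphOf.1 (hl α hαU)
    obtain ⟨r₁, hr₁, hnr⟩ := mem_radColon.1 hn
    obtain ⟨r₂, hr₂, htr⟩ := hrad (1 - t) (by
      rw [mul_sub, mul_one]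
      nth_rewrite 1 [h₁]
      rwa [add_sub_cancel_left])
    refine ⟨r₁ - r₂, sub_mem hr₁ hr₂, ?_⟩
    rw [hl', mul_assoc, hiα, mul_assoc, h₂, mul_add, ← mul_assoc, hiα, ← hnr, mul_add, mul_sub,
      ← htr]
    noncomm_ring
  have hlC : ∀ c ∈ C, ei * c = c → ∃ r ∈ Ring.jacobson Λ, l' * c = α * r := by
    intro c hc hec
    obtain ⟨t, c', hc', n, hn, h₁, h₂⟩ := mem_graphOf.1 (hl c (hCU hc))
    obtain ⟨r₁, hr₁, hnr⟩ := mem_radColon.1 hn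
    obtain ⟨r₂, hr₂, htr⟩ := hrad t (by
      rw [eq_sub_of_add_eq h₁.symm]
      exact C.sub_mem hc hc')
    refine ⟨r₂ + r₁, add_mem hr₂ hr₁, ?_⟩
    rw [hl', mul_assoc, hec, mul_assoc, h₂, mul_add, ← mul_assoc, hiα, ← hnr, htr, mul_add]
  obtain ⟨s, hs⟩ := exists_one_add_mul_eq_one hr
  obtain ⟨m, hm⟩ : ∃ m, m * l' = ei := by
    rcases hi.nilpotent_or_inv K (l := l') (by simp only [hl', ← mul_assoc, hi.1.eq])
      (by rw [hl', mul_assoc, hi.1.eq]) with ⟨n, hn⟩ | ⟨m, hm, -⟩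
    · have hpow : ∀ k : ℕ, l' ^ k * α * s ^ k = α := by
        intro k
        induction k with
        | zero => simp
        | succ k ih =>
          rw [pow_succ, pow_succ', mul_assoc (l' ^ k), hlα, ← mul_assoc, mul_assoc _ _ s,
            mul_assoc α, hs, mul_one, ih]
      exact absurd (by rw [← hpow n, hn, zero_mul, zero_mul]) hα0
    · exact ⟨m, hm⟩
  have hmα : m * α = α * s := by
    calc m * α = m * (α * ((1 + r) * s)) := by rw [hs, mul_one]
      _ = m * l' * α * s := by rw [← mul_assoc α, ← hlα]; simp only [mul_assoc]
      _ = α * s := by rw [hm, hiα]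
  obtain ⟨t, c, hc, hxt⟩ := hdec _ (mul_mul_mem_traceIdeal ei ej x)
  have hec : ei * c = c := by
    rw [eq_sub_of_add_eq' hxt.symm]
    simp only [mul_sub, ← mul_assoc, hi.1.eq, hiα]
  obtain ⟨r', -, hr'⟩ := hlC c hc hec
  refine ⟨t + s * r', ?_⟩
  rw [hxt, mul_add, ← mul_assoc α s, ← hmα, mul_assoc m, ← hr', ← mul_assoc m, hm, hec]

/-- If `xΛ ⊕ xΛ/xΛyΛ` is τ-rigid and `α` generates `xΛyΛ` as a right ideal, then `α` generates
`xΛy` as a left `xΛx`-module. -/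
lemma exists_mul_eq_of_isTauRigid (K : Type) [Field K] [Algebra K Λ]
    [FiniteDimensional K Λ] (hi : IsPrimIdem Λ ei) (hj : IsPrimIdem Λ ej)
    (hiα : ei * α = α) (hαj : α * ej = α) (hα0 : α ≠ 0)
    (h : IsTauRigid (dsum (projMod Λ ei) (quotMod Λ (traceIdeal ei ej))))
    (hgen : ∀ x, ∃ b, ei * x * ej = α * b) (x : Λ) :
    ∃ b, ei * x * ej = ei * b * α := by
  set U := traceIdeal ei ej with hU
  have hi0 : ei * (1 - ei) = 0 := by rw [mul_sub, mul_one, hi.1.eq, sub_self]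
  have hαU : α ∈ U := by
    have := mul_mul_mem_traceIdeal ei ej α
    rwa [hiα, hαj] at this
  have hle : U ≤ Submodule.span Λᵐᵒᵖ {α} ⊔ Submodule.span Λᵐᵒᵖ {1 - ei} := by
    refine Submodule.span_le.2 ?_
    rintro _ (rfl | ⟨x, rfl⟩)
    · exact Submodule.mem_sup_right (Submodule.mem_span_singleton_self _)
    · obtain ⟨b, hb⟩ := hgen x
      exact Submodule.mem_sup_left (mem_span_singleton_op.2 ⟨b, hb.symm⟩)
  have hstep : ∀ b, b * ej = b → ∃ l, ∃ r ∈ Ring.jacobson Λ, ei * l * α = α * b + α * (b * r) := by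
    intro b hbj
    obtain ⟨l, hl⟩ := h.exists_mul_mem
      (graphOf α (α * b) (Submodule.span Λᵐᵒᵖ {1 - ei}) (radColon ei (α * b)))
      (fun u hu => by
        obtain ⟨_, ht, c, hc, rfl⟩ := Submodule.mem_sup.1 (hle hu)
        obtain ⟨t, rfl⟩ := mem_span_singleton_op.1 ht
        exact ⟨α * b * t, mem_graphOf.2 ⟨t, c, hc, 0, zero_mem _, rfl, (add_zero _).symm⟩⟩)
      (by
        rintro ⟨u, y⟩ hp
        obtain ⟨t, c, hc, -, -, rfl, -⟩ := mem_graphOf.1 hp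
        refine U.add_mem (U.smul_mem (MulOpposite.op t) hαU) ?_
        exact (Submodule.span_singleton_le_iff_mem _ _).2 (one_sub_mem_traceIdeal ei ej) hc)
      (mem_graphOf.2 ⟨0, 0, zero_mem _, 1 - ei,
        mem_radColon.2 ⟨0, zero_mem _, by rw [hi0, mul_zero]⟩, by simp, by simp⟩)
    obtain ⟨t, c, hc, n, hn, h₁, h₂⟩ := mem_graphOf.1 (hl α hαU)
    obtain ⟨r₁, hr₁, hnr⟩ := mem_radColon.1 hn
    obtain ⟨z, rfl⟩ := mem_span_singleton_op.1 hc
    have hαt : α = α * t := by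
      have := congrArg (ei * ·) h₁
      simpa only [mul_add, ← mul_assoc, hiα, hi0, zero_mul, add_zero] using this
    have hr₂ : ej * (1 - t) ∈ Ring.jacobson Λ :=
      hj.mem_jacobson_of_mul_mem K hαj (C := ⊥) (by simpa using hα0)
        (by rw [Submodule.mem_bot, mul_sub, mul_one, ← hαt, sub_self])
    refine ⟨l, r₁ - ej * (1 - t), sub_mem hr₁ hr₂, ?_⟩
    rw [mul_assoc, h₂, mul_add, ← hnr, mul_sub b, ← mul_assoc b ej, hbj]
    simp only [← mul_assoc, hiα]
    noncomm_ring
  have : IsArtinianRing Λ := IsArtinianRing.of_finite K Λ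
  obtain ⟨N, hN⟩ := IsSemiprimaryRing.isNilpotent (R := Λ)
  have key : ∀ k ≤ N, ∀ b ∈ Ring.jacobson Λ ^ (N - k), ∃ l, α * b * ej = ei * l * α := by
    intro k
    induction k with
    | zero =>
      intro _ b hb
      rw [Nat.sub_zero, hN] at hb
      have hb : b = 0 := hb
      exact ⟨0, by simp [hb]⟩
    | succ k ih =>
      intro hk b hb
      obtain ⟨l, r, hr, hlr⟩ := hstep (b * ej) (by rw [mul_assoc, hj.1.eq])
      obtain ⟨l', hl'⟩ := ih (by omega) (b * (ej * r)) (by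
        rw [show N - k = (N - (k + 1)) + 1 by omega, Submodule.pow_succ]
        exact Ideal.mul_mem_mul hb (Ideal.mul_mem_left _ _ hr))
      refine ⟨l - l', ?_⟩
      have hj' : ei * l * α * ej = ei * l * α := by rw [mul_assoc, hαj]
      rw [mul_sub, sub_mul, ← hl', ← hj', hlr, add_mul]
      simp only [mul_assoc, hj.1.eq, add_sub_cancel_right]
  obtain ⟨b, hb⟩ := hgen x
  obtain ⟨l, hl⟩ := key N le_rfl b (by rw [Nat.sub_self, Submodule.pow_zero, Ideal.one_eq_top]; trivial)
  exact ⟨l, by rw [← hl, ← hb, mul_assoc _ ej, hj.1.eq]⟩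

/-- The map `Λ → E` of right modules with `1 ↦ x`. -/
def ofOne {E : Type} [AddCommGroup E] [Module Λᵐᵒᵖ E] (x : E) : Λ →ₗ[Λᵐᵒᵖ] E where
  toFun b := MulOpposite.op b • x
  map_add' b c := by rw [MulOpposite.op_add, add_smul]
  map_smul' c b := by
    rw [RingHom.id_apply, smul_smul]
    rfl

lemma ofOne_apply {E : Type} [AddCommGroup E] [Module Λᵐᵒᵖ E] (x : E) (b : Λ) :
    ofOne x b = MulOpposite.op b • x := rfl

/-- If `α` generates `xΛyΛ` on the right and `xΛy` on the left, then `xΛ ⊕ xΛ/xΛyΛ` is τ-rigid. -/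
lemma isTauRigid_of_eq_mul (hi : IsPrimIdem Λ ei) (hiα : ei * α = α) (hαj : α * ej = α)
    (hright : ∀ x, ∃ b, ei * x * ej = α * b) (hleft : ∀ x, ∃ b, ei * x * ej = ei * b * α) :
    IsTauRigid (dsum (projMod Λ ei) (quotMod Λ (traceIdeal ei ej))) := by
  set S := rSpan Λ {1 - ei} with hS
  set U := traceIdeal ei ej with hU
  have hi0 : ei * (1 - ei) = 0 := by rw [mul_sub, mul_one, hi.1.eq, sub_self]
  have heS : 1 - ei ∈ S := Submodule.subset_span rfl
  change IsTauRigid (ModuleCat.of Λᵐᵒᵖ ((Λ ⧸ S) × (Λ ⧸ U)))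
  have hfin : Module.Finite Λᵐᵒᵖ Λ := ⟨⟨{1}, by
    rw [Finset.coe_singleton, eq_top_iff]
    exact fun b _ => mem_span_singleton_op.2 ⟨b, one_mul b⟩⟩⟩
  refine ⟨inferInstanceAs (Module.Finite Λᵐᵒᵖ ((Λ ⧸ S) × (Λ ⧸ U))), ?_⟩
  rintro X ⟨n, F, hF⟩ E f g hf hg hfg
  change ((Fin n → (Λ ⧸ S) × (Λ ⧸ U)) →ₗ[Λᵐᵒᵖ] X) at F
  change (E →ₗ[Λᵐᵒᵖ] (Λ ⧸ S) × (Λ ⧸ U)) at g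
  change ∃ s : (Λ ⧸ S) × (Λ ⧸ U) →ₗ[Λᵐᵒᵖ] E, g.comp s = LinearMap.id
  have hmk : ∀ V : Submodule Λᵐᵒᵖ Λ, 1 - ei ∈ V → ∀ z : Λ ⧸ V, ∃ c,
      MulOpposite.op ej • z = MulOpposite.op α • V.mkQ c := by
    intro V hV z
    obtain ⟨z, rfl⟩ := Submodule.mkQ_surjective _ z
    obtain ⟨c, hc⟩ := hleft z
    refine ⟨c, ?_⟩
    have h1 : ∀ w : Λ, V.mkQ w = V.mkQ (ei * w) := fun w => (Submodule.Quotient.eq V).2 <| by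
      have := V.smul_mem (MulOpposite.op w) hV
      change (1 - ei) * w ∈ V at this
      rwa [sub_mul, one_mul] at this
    change V.mkQ (z * ej) = V.mkQ (c * α)
    rw [h1 (z * ej), h1 (c * α), ← mul_assoc, hc, mul_assoc]
  have hX : ∀ x : X, ∃ x', MulOpposite.op ej • x = MulOpposite.op α • x' := by
    intro x
    obtain ⟨m, rfl⟩ := hF x
    choose c hc using fun k => hmk S heS (m k).1
    choose d hd using fun k => hmk U (one_sub_mem_traceIdeal ei ej) (m k).2
    refine ⟨F fun k => (S.mkQ (c k), U.mkQ (d k)), ?_⟩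
    rw [← map_smul, ← map_smul]
    congr 1
    funext k
    exact Prod.ext (hc k) (hd k)
  have hproj : ∀ (V : Submodule Λᵐᵒᵖ Λ), 1 - ei ∈ V →
      MulOpposite.op ei • V.mkQ (1 : Λ) = V.mkQ 1 := fun V hV =>
    (Submodule.Quotient.eq V).2 <| by
      have := V.neg_mem hV
      rw [neg_sub] at this
      change 1 * ei - 1 ∈ V
      rwa [one_mul]
  obtain ⟨p, hp⟩ := hg (S.mkQ 1, 0)
  obtain ⟨q, hq⟩ := hg (0, U.mkQ 1)
  have hqα : g (MulOpposite.op α • q) = 0 := by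
    rw [map_smul, hq]
    refine Prod.ext (smul_zero _) ((Submodule.Quotient.mk_eq_zero U).2 ?_)
    have := mul_mul_mem_traceIdeal ei ej α
    rw [hiα, hαj] at this
    change 1 * α ∈ U
    rwa [one_mul]
  obtain ⟨x, hx⟩ : MulOpposite.op α • q ∈ LinearMap.range f := hfg ▸ hqα
  obtain ⟨x', hx'⟩ := hX x
  have hxα : MulOpposite.op α • f x' = MulOpposite.op α • q := by
    rw [← map_smul, ← hx', map_smul, hx, smul_smul, ← MulOpposite.op_mul, hαj]
  have hgf : ∀ y, g (f y) = 0 := fun y => by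
    have : f y ∈ LinearMap.ker g := hfg ▸ LinearMap.mem_range_self f y
    exact this
  let sp : (Λ ⧸ S) →ₗ[Λᵐᵒᵖ] E := S.liftQ (ofOne (MulOpposite.op ei • p)) <| by
    rw [hS, rSpan, Submodule.span_singleton_le_iff_mem, LinearMap.mem_ker, ofOne_apply, smul_smul,
      ← MulOpposite.op_mul, hi0, MulOpposite.op_zero, zero_smul]
  let sq : (Λ ⧸ U) →ₗ[Λᵐᵒᵖ] E := U.liftQ (ofOne (MulOpposite.op ei • (q - f x'))) <| by
    refine Submodule.span_le.2 ?_
    rintro _ (rfl | ⟨y, rfl⟩)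
    · rw [SetLike.mem_coe, LinearMap.mem_ker, ofOne_apply, smul_smul, ← MulOpposite.op_mul, hi0,
        MulOpposite.op_zero, zero_smul]
    · obtain ⟨b, hb⟩ := hright y
      rw [SetLike.mem_coe, LinearMap.mem_ker, ofOne_apply, smul_smul, ← MulOpposite.op_mul, hb,
        ← mul_assoc, hiα, MulOpposite.op_mul, mul_smul, smul_sub, hxα, sub_self, smul_zero]
  refine ⟨LinearMap.coprod sp sq, ?_⟩
  refine LinearMap.prod_ext ?_ ?_
  · refine Submodule.linearMap_qext _ (LinearMap.ext fun b => ?_)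
    change g (sp (S.mkQ b) + sq 0) = (S.mkQ b, 0)
    rw [map_zero, add_zero]
    change g (MulOpposite.op b • MulOpposite.op ei • p) = _
    rw [map_smul, map_smul, hp]
    refine Prod.ext ?_ (by simp)
    change MulOpposite.op b • (MulOpposite.op ei • S.mkQ (1 : Λ)) = S.mkQ b
    rw [hproj S heS, ← map_smul]
    exact congrArg S.mkQ (one_mul b)
  · refine Submodule.linearMap_qext _ (LinearMap.ext fun b => ?_)
    change g (sp 0 + sq (U.mkQ b)) = (0, U.mkQ b)
    rw [map_zero, zero_add]
    change g (MulOpposite.op b • MulOpposite.op ei • (q - f x')) = _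
    rw [map_smul, map_smul, map_sub, hgf, sub_zero, hq]
    refine Prod.ext (by simp) ?_
    change MulOpposite.op b • (MulOpposite.op ei • U.mkQ (1 : Λ)) = U.mkQ b
    rw [hproj U (one_sub_mem_traceIdeal ei ej), ← map_smul]
    exact congrArg U.mkQ (one_mul b)

/-- Over a basic algebra, `xΛy` lies in the radical for distinct members `x`, `y` of a complete
family of orthogonal primitive idempotents. -/
lemma mul_mul_mem_jacobson (K : Type) [Field K] [Algebra K Λ] [FiniteDimensional K Λ]
    (hi : IsPrimIdem Λ ei) (hj : IsPrimIdem Λ ej)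
    (hiso : IsEmpty (↥(projMod Λ ei) ≃ₗ[Λᵐᵒᵖ] ↥(projMod Λ ej))) (x : Λ) :
    ei * x * ej ∈ Ring.jacobson Λ := by
  by_contra hx
  obtain ⟨y, hy⟩ := hi.exists_mul_eq K (by simp only [← mul_assoc, hi.1.eq]) hx
  set u := ei * x * ej with hu
  set v := ej * y * ei with hv
  have huj : u * ej = u := by rw [hu, mul_assoc, hj.1.eq]
  have hiu : ei * u = u := by simp only [hu, ← mul_assoc, hi.1.eq]
  have hvi : v * ei = v := by rw [hv, mul_assoc, hi.1.eq]
  have hjv : ej * v = v := by simp only [hv, ← mul_assoc, hj.1.eq]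
  have huv : u * v = ei := by
    rw [hv, ← mul_assoc, ← mul_assoc, huj, hy, hi.1.eq]
  have hidem : v * u * (v * u) = v * u := by
    rw [mul_assoc, ← mul_assoc u, huv, hiu]
  have hvu : v * u = ej := by
    have h₁ : v * u * ej = v * u := by rw [mul_assoc, huj]
    have h₂ : ej * (v * u) = v * u := by rw [← mul_assoc, hjv]
    rcases hj.2.2 (v * u) (ej - v * u) hidem
      (by simp only [IsIdempotentElem, mul_sub, sub_mul, hidem, h₁, h₂, hj.1.eq]; abel)
      (by rw [mul_sub, h₁, hidem, sub_self]) (by rw [sub_mul, h₂, hidem, sub_self])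
      (by abel) with h | h
    · refine absurd ?_ hi.2.1
      calc ei = u * (v * u) * v := by rw [← mul_assoc u, huv, hiu, huv]
        _ = 0 := by rw [h, mul_zero, zero_mul]
    · exact (sub_eq_zero.1 h).symm
  have hmap : ∀ {p q z : Λ}, z * p = z → rSpan Λ {1 - p} ≤ (rSpan Λ {1 - q}).comap (mulLeftHom z) :=
    fun {p q z} hz => by
      rw [rSpan, Submodule.span_singleton_le_iff_mem]
      change z * (1 - p) ∈ rSpan Λ {1 - q}
      rw [mul_sub, mul_one, hz, sub_self]
      exact zero_mem _
  have hmk : ∀ p b : Λ, (rSpan Λ {1 - p}).mkQ (p * b) = (rSpan Λ {1 - p}).mkQ b := fun p b => by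
    refine (Submodule.Quotient.eq _).2 (mem_span_singleton_op.2 ⟨-b, ?_⟩)
    noncomm_ring
  refine hiso.false (LinearEquiv.ofLinearMap
    (Submodule.mapQ (rSpan Λ {1 - ei}) (rSpan Λ {1 - ej}) (mulLeftHom v) (hmap hvi))
    (Submodule.mapQ (rSpan Λ {1 - ej}) (rSpan Λ {1 - ei}) (mulLeftHom u) (hmap huj)) ?_ ?_)
  · refine Submodule.linearMap_qext _ (LinearMap.ext fun b => ?_)
    change Submodule.mkQ _ (v * (u * b)) = Submodule.mkQ _ b
    rw [← mul_assoc, hvu, hmk]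
  · refine Submodule.linearMap_qext _ (LinearMap.ext fun b => ?_)
    change Submodule.mkQ _ (u * (v * b)) = Submodule.mkQ _ b
    rw [← mul_assoc, huv, hmk]

lemma mem_radK_iff {K : Type} [Field K] [Algebra K Λ] {x : Λ} :
    x ∈ radK K Λ ↔ x ∈ Ring.jacobson Λ := by
  rw [radK, Submodule.restrictScalars_mem, ← Ring.jacobson_eq_sInf_isMaximal]

/-- The square of the radical as a right ideal. -/
noncomputable def rightRadSq (K Λ : Type) [Field K] [Ring Λ] [Algebra K Λ] :
    Submodule Λᵐᵒᵖ Λ where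
  carrier := (radK K Λ * radK K Λ : Submodule K Λ)
  add_mem' := add_mem
  zero_mem' := zero_mem _
  smul_mem' b x hx := by
    refine Submodule.mul_induction_on (C := fun x => x * b.unop ∈ radK K Λ * radK K Λ) hx ?_ ?_
    · intro m hm n hn
      rw [mul_assoc]
      refine Submodule.mul_mem_mul hm ?_
      rw [mem_radK_iff] at hn ⊢
      exact Ideal.mul_mem_right _ _ hn
    · intro x y hx hy
      rw [add_mul]
      exact add_mem hx hy

lemma mem_rightRadSq {K : Type} [Field K] [Algebra K Λ] {x : Λ} :
    x ∈ rightRadSq K Λ ↔ x ∈ radK K Λ * radK K Λ :=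
  Iff.rfl

/-- An arrow does not lie in the square of the radical. -/
lemma IsGabrielPres.arr_notMem {K ι : Type} [Field K] [Algebra K Λ] [Fintype ι] [DecidableEq ι]
    {e : ι → Λ} {Arr : ι → ι → Type} [∀ i j, Fintype (Arr i j)] {arr : ∀ i j, Arr i j → Λ}
    (hpres : IsGabrielPres Λ K e Arr arr) {i j : ι} (a : Arr i j) :
    arr i j a ∉ radK K Λ * radK K Λ := by
  classical
  intro ha
  have := hpres.2.2.2.2 (Pi.single ⟨i, j, a⟩ 1)
    (by simpa [Pi.single_apply, ite_smul] using ha) ⟨i, j, a⟩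
  simp at this

end Arrow

end TauTilting

open TauTilting in
/-- Suppose there is an arrow `α : i → j` in `Q°` (so
`i ≠ j`).  Then `αΛe_j = e_iΛe_j = e_iΛα` if and only if the right module
`P_i ⊕ (e_iΛ / e_iΛe_jΛ)` is τ-rigid.  Here `e_iΛ/e_iΛe_jΛ` is encoded as
`Λ/((1-e_i)Λ + e_iΛe_jΛ)`. -/
theorem statement15
    (K : Type) [Field K]
    (Λ : Type) [Ring Λ] [Algebra K Λ] [FiniteDimensional K Λ]
    (ι : Type) [Fintype ι] [DecidableEq ι] (e : ι → Λ)
    (Arr : ι → ι → Type) [∀ i j, Fintype (Arr i j)] (arr : ∀ i j, Arr i j → Λ)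
    (hpres : IsGabrielPres Λ K e Arr arr)
    (i j : ι) (hij : i ≠ j) (a : Arr i j) :
    ((Set.range fun b => arr i j a * b * e j) = (Set.range fun b => e i * b * e j) ∧
     (Set.range fun b => e i * b * arr i j a) = (Set.range fun b => e i * b * e j)) ↔
    IsTauRigid (dsum (projMod Λ (e i))
      (quotMod Λ (Submodule.span Λᵐᵒᵖ ({1 - e i} ∪ {y : Λ | ∃ x, y = e i * x * e j})))) := by
  have hi := hpres.1.1 i
  have hj := hpres.1.1 j
  obtain ⟨-, hα⟩ := hpres.2.2.1 i j a
  have hαQ : arr i j a ∉ rightRadSq K Λ := fun h => hpres.arr_notMem a (mem_rightRadSq.1 h)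
  have hα0 : arr i j a ≠ 0 := fun h0 => hαQ (h0 ▸ zero_mem _)
  generalize arr i j a = α at *
  have hiα : e i * α = α := by rw [← hα]; simp only [← mul_assoc, hi.1.eq]
  have hαj : α * e j = α := by rw [← hα, mul_assoc, hj.1.eq]
  constructor
  · rintro ⟨hr, hl⟩
    refine isTauRigid_of_eq_mul hi hiα hαj (fun x => ?_) (fun x => ?_)
    · obtain ⟨b, hb⟩ := hr.ge ⟨x, rfl⟩
      exact ⟨b * e j, by rw [← mul_assoc]; exact hb.symm⟩
    · obtain ⟨b, hb⟩ := hl.ge ⟨x, rfl⟩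
      exact ⟨b, hb.symm⟩
  · intro h
    have hgen := exists_eq_mul_of_isTauRigid K hi hj hiα hαj h (rightRadSq K Λ) hαQ
      fun x r hr => mem_rightRadSq.2 <| Submodule.mul_mem_mul
        (mem_radK_iff.2 (mul_mul_mem_jacobson K hi hj (hpres.2.1 i j hij) x)) (mem_radK_iff.2 hr)
    refine ⟨Set.Subset.antisymm ?_ ?_, Set.Subset.antisymm ?_ ?_⟩
    · rintro _ ⟨b, rfl⟩
      exact ⟨α * b, by simp only [← mul_assoc, hiα]⟩
    · rintro _ ⟨x, rfl⟩
      obtain ⟨b, hb⟩ := hgen x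
      exact ⟨b, by simp only [← hb, mul_assoc, hj.1.eq]⟩
    · rintro _ ⟨b, rfl⟩
      exact ⟨b * α, by simp only [mul_assoc, hαj]⟩
    · rintro _ ⟨x, rfl⟩
      obtain ⟨b, hb⟩ := exists_mul_eq_of_isTauRigid K hi hj hiα hαj hα0 h hgen x
      exact ⟨b, hb.symm⟩
end
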